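/- Let f : ℝ^d → ℝ be twice continuously differentiable and convex with 0 ⪯ ∇²f(x) ⪯ L·I for all x, for some constant 0 < L < ∞, and assume the set N* of minimizers of f is nonempty with optimal value f*. Fix constants 0 < Γ ≤ Δ and a stepsize 0 < ε < 2Γ/(L·Δ²). Let (A(t))_{t≥0} be any sequence of symmetric d×d matrices satisfying Γ·I ⪯ A(t) ⪯ Δ·I for all t, and define the iterates x(t+1) = x(t) − ε·A(t)·∇f(x(t)) from an arbitrary initial point x(0). If in addition the distances from the iterates to the minimizer set are uniformly bounded, i.e. there is D̄ < ∞ with dist(x(t), N*) ≤ D̄ for all t, then f(x(t)) − f* converges to zero at rate o(1/t), i.e. lim_{t→∞} t·(f(x(t)) − f*) = 0. -/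

import Mathlib

open RealInnerProductSpace Filter

namespace DB

set_option linter.unusedSectionVars false

variable {E : Type*} [NormedAddCommGroup E] [InnerProductSpace ℝ E]

/-- step length -/
noncomputable def dl (x : ℕ → E) (i : ℕ) : ℝ := ‖x (i+1) - x i‖

/-- arc length -/
noncomputable def lam (x : ℕ → E) (k : ℕ) : ℝ := ∑ i ∈ Finset.range k, dl x i

structure CurveSys (x n : ℕ → E) (a b : ℕ) (D : ℝ) : Prop where
  pos : 0 < D
  step : ∀ i, a ≤ i → i < b → dl x i ≤ D
  back : ∀ i j, a ≤ j → j < i → i < b → ⟪n i, x j - x i⟫ ≤ D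

structure Base (x n : ℕ → E) (c : ℝ) : Prop where
  cpos : 0 < c
  cle : c ≤ 1
  unit : ∀ i, ‖n i‖ = 1
  dpos : ∀ i, 0 < dl x i
  fwd : ∀ i j, i < j → ⟪n i, x j - x i⟫ ≤ -(c * dl x i)

lemma lam_succ (x : ℕ → E) (k : ℕ) : lam x (k+1) = lam x k + dl x k := by
  simp [lam, Finset.sum_range_succ]

lemma dl_nonneg (x : ℕ → E) (k : ℕ) : 0 ≤ dl x k := norm_nonneg _

lemma lam_mono (x : ℕ → E) : Monotone (lam x) :=
  monotone_nat_of_le_succ fun k => by rw [lam_succ]; linarith [dl_nonneg x k]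

lemma Base.lam_lt {x n : ℕ → E} {c : ℝ} (h : Base x n c) : StrictMono (lam x) :=
  strictMono_nat_of_lt_succ fun k => by rw [lam_succ]; linarith [h.dpos k]

lemma norm_le_lam (x : ℕ → E) {i j : ℕ} (h : i ≤ j) : ‖x j - x i‖ ≤ lam x j - lam x i := by
  induction j, h using Nat.le_induction with
  | base => simp
  | succ k hk ih =>
    rw [lam_succ]
    have : x (k+1) - x i = (x (k+1) - x k) + (x k - x i) := by abel
    rw [this]
    refine (norm_add_le _ _).trans ?_
    have : ‖x (k+1) - x k‖ = dl x k := rfl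
    linarith

lemma norm_le_lam2 (x : ℕ → E) {a b i j : ℕ} (hi : a ≤ i) (hib : i ≤ b) (hj : a ≤ j) (hjb : j ≤ b) :
    ‖x j - x i‖ ≤ lam x b - lam x a := by
  have h1 := lam_mono x hi
  have h2 := lam_mono x hib
  have h3 := lam_mono x hj
  have h4 := lam_mono x hjb
  rcases le_total i j with h | h
  · linarith [norm_le_lam x h]
  · rw [norm_sub_rev]; linarith [norm_le_lam x h]

lemma CurveSys.mono {x n : ℕ → E} {a b a' b' : ℕ} {D D' : ℝ} (h : CurveSys x n a b D)
    (ha : a ≤ a') (hb : b' ≤ b) (hD : D ≤ D') : CurveSys x n a' b' D' where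
  pos := h.pos.trans_le hD
  step i h1 h2 := (h.step i (ha.trans h1) (h2.trans_le hb)).trans hD
  back i j h1 h2 h3 := (h.back i j (ha.trans h1) h2 (h3.trans_le hb)).trans hD

lemma Base.fwd0 {x n : ℕ → E} {c : ℝ} (h : Base x n c) {i j : ℕ} (hij : i ≤ j) :
    ⟪n i, x j - x i⟫ ≤ 0 := by
  rcases hij.eq_or_lt with rfl | hij
  · simp
  · have := h.fwd i j hij
    have := mul_nonneg h.cpos.le (dl_nonneg x i)
    linarith

lemma Base.drop {x n : ℕ → E} {c : ℝ} (h : Base x n c) {a b : ℕ} {D : ℝ} (hD : 0 < D)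
    (hn : ¬ CurveSys x n a b D) : ∃ i j, a ≤ i ∧ i < b ∧ a ≤ j ∧ j < b ∧
      ∀ z, b ≤ z → ⟪n i, x z - x j⟫ ≤ -(c * D) := by
  by_contra hcon
  push Not at hcon
  apply hn
  refine ⟨hD, ?_, ?_⟩
  · intro i h1 h2
    by_contra hlt
    push Not at hlt
    obtain ⟨z, hz, hz2⟩ := hcon i i h1 h2 h1 h2
    have := h.fwd i z (by omega)
    have := mul_le_mul_of_nonneg_left hlt.le h.cpos.le
    linarith
  · intro i j h1 h2 h3
    by_contra hlt
    push Not at hlt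
    obtain ⟨z, hz, hz2⟩ := hcon i j (by omega) h3 h1 (by omega)
    have h4 := h.fwd0 (i := i) (j := z) (by omega)
    have h5 : ⟪n i, x z - x j⟫ = ⟪n i, x z - x i⟫ - ⟪n i, x j - x i⟫ := by
      rw [← inner_sub_right]; congr 1; abel
    have : c * D ≤ 1 * D := mul_le_mul_of_nonneg_right h.cle hD.le
    linarith

lemma Base.inner_le {x n : ℕ → E} {c : ℝ} (h : Base x n c) (i : ℕ) (v : E) : |⟪n i, v⟫| ≤ ‖v‖ := by
  have := abs_real_inner_le_norm (n i) v
  rwa [h.unit, one_mul] at this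

/-- Window with approximating normals. -/
structure Win (x n p : ℕ → E) (Y : E →ₗ[ℝ] E) (N : Set E) (a0 b0 : ℕ) (t1 : ℝ) : Prop where
  mem : ∀ t, a0 ≤ t → t < b0 → p t ∈ N
  near : ∀ t, a0 ≤ t → t < b0 → ‖n t - p t‖ ≤ t1
  nunit : ∀ q ∈ N, ‖q‖ = 1
  Yle : ∀ v, ‖Y v‖ ≤ ‖v‖
  Yin : ∀ q ∈ N, ∀ v, ⟪q, v⟫ = ⟪q, Y v⟫
  t1nn : 0 ≤ t1

section win
variable {x n p : ℕ → E} {Y : E →ₗ[ℝ] E} {N : Set E} {a0 b0 : ℕ} {t1 c : ℝ}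

lemma Win.B1 (w : Win x n p Y N a0 b0 t1) {q : E} (hq : q ∈ N) {t : ℕ} (h1 : a0 ≤ t) (h2 : t < b0)
    (v : E) : |⟪q, v⟫ - ⟪n t, v⟫| ≤ ‖p t - q‖ * ‖Y v‖ + t1 * ‖v‖ := by
  have e1 : ⟪q, v⟫ - ⟪n t, v⟫ = -⟪p t - q, Y v⟫ - ⟪n t - p t, v⟫ := by
    rw [inner_sub_left, inner_sub_left, ← w.Yin q hq, ← w.Yin _ (w.mem t h1 h2)]; ring
  have e2 := abs_real_inner_le_norm (p t - q) (Y v)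
  have e3 := abs_real_inner_le_norm (n t - p t) v
  have e4 := mul_le_mul_of_nonneg_right (w.near t h1 h2) (norm_nonneg v)
  rw [e1]
  rw [abs_le] at *
  constructor <;> linarith [e2.1, e2.2, e3.1, e3.2]

lemma Win.B2 (w : Win x n p Y N a0 b0 t1) {t : ℕ} (h1 : a0 ≤ t) (h2 : t < b0)
    (v : E) : |⟪n t, v⟫| ≤ ‖Y v‖ + t1 * ‖v‖ := by
  have e := w.B1 (w.mem t h1 h2) h1 h2 v
  have e2 := abs_real_inner_le_norm (p t) (Y v)
  rw [w.nunit _ (w.mem t h1 h2), ← w.Yin _ (w.mem t h1 h2)] at e2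
  simp only [sub_self, norm_zero, zero_mul, zero_add, one_mul] at e e2
  rw [abs_le] at *
  constructor <;> linarith [e2.1, e2.2, e.1, e.2]

lemma Win.anchor (w : Win x n p Y N a0 b0 t1) (h : Base x n c) {a a' t z : ℕ} {β : E} {τ S T : ℝ}
    (ha : a0 ≤ a) (ha' : a' ≤ b0) (hat : a ≤ t) (hta : t < a') (hβ : β ∈ N) (hp : ‖p t - β‖ ≤ τ)
    (hz : a ≤ z) (hS : ‖Y (x z - x a)‖ ≤ S) (hT : lam x z - lam x a ≤ T) :
    ⟪β, x z - x a⟫ ≤ (lam x a' - lam x a) + τ * S + t1 * T := by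
  have hτ : 0 ≤ τ := (norm_nonneg _).trans hp
  have hS0 : 0 ≤ S := (norm_nonneg _).trans hS
  have hn := norm_le_lam x hz
  have hT0 : 0 ≤ T := by linarith [norm_nonneg (x z - x a)]
  have g1 : 0 ≤ τ * S := mul_nonneg hτ hS0
  have g2 : 0 ≤ t1 * T := mul_nonneg w.t1nn hT0
  rcases le_or_gt z t with hzt | hzt
  · have := real_inner_le_norm β (x z - x a)
    rw [w.nunit β hβ, one_mul] at this
    have := lam_mono x (show z ≤ a' by omega)
    linarith
  · have e := (abs_le.1 (w.B1 hβ (ha.trans hat) (by omega : t < b0) (x z - x a))).2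
    have e1 : ‖p t - β‖ * ‖Y (x z - x a)‖ ≤ τ * S := by gcongr
    have e2 : t1 * ‖x z - x a‖ ≤ t1 * T := mul_le_mul_of_nonneg_left (hn.trans hT) w.t1nn
    have e3 : ⟪n t, x z - x a⟫ = ⟪n t, x z - x t⟫ + ⟪n t, x t - x a⟫ := by
      rw [← inner_add_right]; congr 1; abel
    have e4 := h.fwd0 hzt.le
    have e5 := (abs_le.1 (h.inner_le t (x t - x a))).2
    have e6 := norm_le_lam x hat
    have e7 := lam_mono x hta.le
    linarith

lemma exists_back (x : ℕ → E) {a i : ℕ} {w : ℝ} (hw : 0 < w) (hai : a ≤ i)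
    (h : w ≤ lam x i - lam x a) :
    ∃ j, a ≤ j ∧ j < i ∧ w ≤ lam x i - lam x j ∧ lam x i - lam x (j+1) < w := by
  by_contra hcon
  push Not at hcon
  have key : ∀ j, a ≤ j → j ≤ i → w ≤ lam x i - lam x j := by
    intro j hj
    induction j, hj using Nat.le_induction with
    | base => intro _; exact h
    | succ k hk ih => intro hki; exact hcon k hk (by omega) (ih (by omega))
  have := key i hai le_rfl
  linarith
end win
end DB

namespace DB
set_option linter.unusedSectionVars false
set_option linter.unusedVariables false
variable {E : Type*} [NormedAddCommGroup E] [InnerProductSpace ℝ E]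
section win
variable {x n p : ℕ → E} {Y : E →ₗ[ℝ] E} {N : Set E} {a0 b0 : ℕ} {t1 c : ℝ}

/-- all members of the net are visited -/
def Vis (p : ℕ → E) (B : Finset E) (τ : ℝ) (a b : ℕ) : Prop :=
  ∀ β ∈ B, ∃ t, a ≤ t ∧ t < b ∧ ‖p t - β‖ ≤ τ

/-- windows of large relative length visit every normal -/
def MinProp (x n p : ℕ → E) (N : Set E) (a0 b0 : ℕ) (Λ τ : ℝ) : Prop :=
  ∀ a b D, a0 ≤ a → b ≤ b0 → CurveSys x n a b D → Λ * D ≤ lam x b - lam x a →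
    ∀ q ∈ N, ∃ t, a ≤ t ∧ t < b ∧ ‖p t - q‖ ≤ τ

lemma lem_i (w : Win x n p Y N a0 b0 t1) (h : Base x n c) {a a' b : ℕ} {B : Finset E}
    {θ τ τ' τ2 ω ρ K Λ2 S : ℝ}
    (hBN : ∀ β ∈ B, β ∈ N) (hnet : ∀ q ∈ N, ∃ β ∈ B, ‖q - β‖ ≤ ρ)
    (hθ : 0 < θ) (hθY : ∀ v, ∃ q ∈ N, θ * ‖Y v‖ ≤ |⟪q, Y v⟫|)
    (hM : MinProp x n p N a0 b0 Λ2 τ2)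
    (hτ : τ ≤ θ/16) (hτ'0 : 0 < τ') (hτ' : τ' ≤ θ/16) (hτ2 : τ2 ≤ θ/16) (hω0 : 0 < ω) (hω1 : ω ≤ 1)
    (hω : ω ≤ θ/16) (hρ : ρ ≤ θ/16) (hτ'ω : τ' ≤ ω) (hΛ2 : Λ2 * τ' ≤ ω) (hK : 16 ≤ θ * K)
    (ha : a0 ≤ a) (haa : a ≤ a') (hab : a' ≤ b) (hb : b ≤ b0) (hV : Vis p B τ a a') (hS0 : 0 < S)
    (hS : ∀ t, a ≤ t → t ≤ b → ‖Y (x t - x a)‖ ≤ S)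
    (hSat : ∃ t, a ≤ t ∧ t ≤ b ∧ ‖Y (x t - x a)‖ = S)
    (hKS : K * (lam x a' - lam x a) ≤ S) (hT : t1 * (lam x b - lam x a) ≤ θ/16 * S) :
    ¬ CurveSys x n a b (τ' * S) := by
  intro hC
  obtain ⟨i, hai, hib, hiS⟩ := hSat
  have hs : lam x a' - lam x a ≤ θ/16 * S := by
    have h0 : 0 ≤ lam x a' - lam x a := by linarith [lam_mono x haa]
    have := mul_le_mul_of_nonneg_right hK h0
    have := mul_le_mul_of_nonneg_left hKS hθ.le
    nlinarith
  have hlen : S ≤ lam x i - lam x a := by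
    rw [← hiS]; exact (w.Yle _).trans (norm_le_lam x hai)
  obtain ⟨j, haj, hji, hj1, hj2⟩ := exists_back x (w := ω * S) (mul_pos hω0 hS0) hai
    (by nlinarith)
  obtain ⟨q, hq, hqe⟩ := hθY (x i - x a)
  rw [hiS, ← w.Yin q hq] at hqe
  have hδ := hC.step j haj (by omega)
  have hτS : τ' * S ≤ ω * S := by gcongr
  have hlam2 : lam x i - lam x j ≤ 2 * (ω * S) := by
    rw [lam_succ] at hj2; linarith
  obtain ⟨t, hjt, hti, htq⟩ := hM j i (τ' * S) (by omega) (by omega) (hC.mono haj hib le_rfl)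
    (by nlinarith) q hq
  have hTi : ∀ u, a ≤ u → u ≤ b → t1 * ‖x u - x a‖ ≤ θ/16 * S := fun u h1 h2 =>
    (mul_le_mul_of_nonneg_left (norm_le_lam2 x le_rfl (by omega) h1 h2) w.t1nn).trans hT
  have m1 := w.B1 hq (by omega : a0 ≤ t) (by omega : t < b0) (x i - x a)
  have m2 : ‖p t - q‖ * ‖Y (x i - x a)‖ ≤ θ/16 * S := by
    rw [hiS]; exact mul_le_mul_of_nonneg_right (htq.trans hτ2) hS0.le
  have m3 := hTi i hai hib
  have m4 : ⟪n t, x i - x a⟫ = ⟪n t, x i - x t⟫ + ⟪n t, x t - x a⟫ := by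
      rw [← inner_add_right]; congr 1; abel
  have m5 := h.inner_le t (x i - x t)
  have m6 := norm_le_lam2 x hjt hti.le hji.le le_rfl
  have hωS : ω * S ≤ θ/16 * S := by gcongr
  have lower : - (θ/16 * S) ≤ ⟪n t, x t - x a⟫ := by
    rcases (haj.trans hjt).eq_or_lt with rfl | hat
    · simp; positivity
    · have := hC.back t a le_rfl hat (by omega)
      rw [← neg_sub, inner_neg_right] at this
      linarith
  have upper : ⟪n t, x t - x a⟫ ≤ 5 * (θ/16 * S) := by
    obtain ⟨β, hβ, hβ2⟩ := hnet (p t) (w.mem t (by omega) (by omega))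
    have u1 := w.B1 (hBN β hβ) (by omega : a0 ≤ t) (by omega : t < b0) (x t - x a)
    have hYt := hS t (by omega) (by omega)
    have u2 : ‖p t - β‖ * ‖Y (x t - x a)‖ ≤ θ/16 * S :=
      mul_le_mul (hβ2.trans hρ) hYt (norm_nonneg _) (by positivity)
    have u3 := hTi t (by omega) (by omega)
    obtain ⟨t', ht1, ht2, ht3⟩ := hV β hβ
    have u4 := w.anchor h ha (by omega) ht1 ht2 (hBN β hβ) (ht3.trans hτ) (by omega : a ≤ t) hYt
      (by linarith [lam_mono x (by omega : t ≤ b)] : _ ≤ lam x b - lam x a)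
    linarith [(abs_le.1 u1).1]
  have hpos : 0 < θ * S := by positivity
  rcases abs_le.1 m1 with ⟨m11, m12⟩
  rcases abs_le.1 m5 with ⟨m51, m52⟩
  rcases le_abs.1 hqe with h' | h' <;> linarith

lemma lem_small (w : Win x n p Y N a0 b0 t1) (h : Base x n c) {a a' b : ℕ} {B : Finset E}
    {τ S T : ℝ} (hBN : ∀ β ∈ B, β ∈ N)
    (ha : a0 ≤ a) (ha' : a' ≤ b0) (hab : a ≤ b) (hV : Vis p B τ a a')
    (hS : ‖Y (x b - x a)‖ ≤ S) (hT : lam x b - lam x a ≤ T) :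
    ⟪∑ β ∈ B, β, x b - x a⟫ ≤ B.card * ((lam x a' - lam x a) + τ * S + t1 * T) := by
  rw [sum_inner, ← nsmul_eq_mul]
  apply Finset.sum_le_card_nsmul
  intro β hβ
  obtain ⟨t', ht1, ht2, ht3⟩ := hV β hβ
  exact w.anchor h ha ha' ht1 ht2 (hBN β hβ) ht3 hab hS hT

lemma lem_ii (w : Win x n p Y N a0 b0 t1) (h : Base x n c) {a a' b : ℕ} {B : Finset E}
    {τ τ' ρ K S : ℝ}
    (hBN : ∀ β ∈ B, β ∈ N) (hnet : ∀ q ∈ N, ∃ β ∈ B, ‖q - β‖ ≤ ρ)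
    (hτ'0 : 0 < τ') (hτ0 : 0 ≤ τ) (hρ0 : 0 ≤ ρ)
    (hρ : ρ ≤ c * τ' / 8) (hK0 : 0 < K) (hK : 24 * B.card ≤ c * τ' * K)
    (hτ : B.card * τ ≤ c * τ' / 16)
    (ha : a0 ≤ a) (haa : a ≤ a') (hab : a' ≤ b) (hb : b ≤ b0) (hV : Vis p B τ a a') (hS0 : 0 < S)
    (hS : ∀ t, a ≤ t → t ≤ b → ‖Y (x t - x a)‖ ≤ S)
    (hKS : K * (lam x a' - lam x a) ≤ S)
    (hT : (B.card + 1) * (t1 * (lam x b - lam x a)) ≤ c * τ' / 8 * S)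
    (hC : ¬ CurveSys x n a b (τ' * S)) :
    ⟪∑ β ∈ B, β, x b - x a⟫ ≤ - (c * τ' / 4 * S) := by
  classical
  obtain ⟨i, j, hai, hib, haj, hjb, hd⟩ := h.drop (mul_pos hτ'0 hS0) hC
  have hd := hd b le_rfl
  set T := lam x b - lam x a with hTdef
  set s := lam x a' - lam x a with hs
  have hs0 : 0 ≤ s := by linarith [lam_mono x haa]
  have hT0 : 0 ≤ T := by linarith [lam_mono x (haa.trans hab)]
  obtain ⟨β0, hβ0, hβ02⟩ := hnet (p i) (w.mem i (by omega) (by omega))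
  have u1 := (abs_le.1 (w.B1 (hBN β0 hβ0) (by omega : a0 ≤ i) (by omega : i < b0) (x b - x j))).2
  have hY2 : ‖Y (x b - x j)‖ ≤ 2 * S := by
    have : x b - x j = (x b - x a) - (x j - x a) := by abel
    rw [this, map_sub]
    have := norm_sub_le (Y (x b - x a)) (Y (x j - x a))
    linarith [hS b (by omega) le_rfl, hS j haj hjb.le]
  have u2 : ‖p i - β0‖ * ‖Y (x b - x j)‖ ≤ ρ * (2 * S) :=
    mul_le_mul hβ02 hY2 (norm_nonneg _) hρ0
  have u3 : t1 * ‖x b - x j‖ ≤ t1 * T :=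
    mul_le_mul_of_nonneg_left (norm_le_lam2 x haj hjb.le (by omega) le_rfl) w.t1nn
  obtain ⟨t', ht1, ht2, ht3⟩ := hV β0 hβ0
  have u4 := w.anchor h ha (by omega) ht1 ht2 (hBN β0 hβ0) ht3 haj (hS j haj hjb.le)
    (by linarith [lam_mono x hjb.le] : _ ≤ T)
  have e : ⟪β0, x b - x a⟫ = ⟪β0, x b - x j⟫ + ⟪β0, x j - x a⟫ := by
    rw [← inner_add_right]; congr 1; abel
  rw [sum_inner, ← Finset.add_sum_erase B _ hβ0]
  have u5 : ∑ β ∈ B.erase β0, ⟪β, x b - x a⟫ ≤ ((B.erase β0).card : ℝ) * (s + τ * S + t1 * T) := by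
    rw [← nsmul_eq_mul]
    apply Finset.sum_le_card_nsmul
    intro β hβ
    have hβ := Finset.mem_of_mem_erase hβ
    obtain ⟨t', ht1, ht2, ht3⟩ := hV β hβ
    exact w.anchor h ha (by omega) ht1 ht2 (hBN β hβ) ht3 (by omega) (hS b (by omega) le_rfl) le_rfl
  have hcard : ((B.erase β0).card : ℝ) = B.card - 1 := by
    have := Finset.card_erase_add_one hβ0
    rw [← this]; push_cast; ring
  rw [hcard] at u5
  have v1 : (B.card : ℝ) * s ≤ c * τ' / 24 * S := by
    have := mul_le_mul_of_nonneg_right hK hs0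
    have := mul_le_mul_of_nonneg_left hKS (mul_pos h.cpos hτ'0).le
    linarith
  have v2 : (B.card : ℝ) * (τ * S) ≤ c * τ' / 16 * S := by
    rw [← mul_assoc]; exact mul_le_mul_of_nonneg_right hτ hS0.le
  have v3 : ρ * (2 * S) ≤ c * τ' / 4 * S := by nlinarith
  have v4 : 0 < c * τ' * S := mul_pos (mul_pos h.cpos hτ'0) hS0
  nlinarith

end win
end DB

namespace DB
set_option linter.unusedSectionVars false
set_option linter.unusedVariables false
variable {E : Type*} [NormedAddCommGroup E] [InnerProductSpace ℝ E]

lemma packing [FiniteDimensional ℝ E] {ε : ℝ} (hε : 0 < ε) : ∃ P : ℕ, 1 ≤ P ∧ ∀ y : ℕ → E,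
    (∀ i < P, ‖y i‖ ≤ 1) → ∃ i j, i < j ∧ j < P ∧ ‖y j - y i‖ < ε := by
  classical
  obtain ⟨t, -, htf, htc⟩ := (isCompact_closedBall (0 : E) 1).finite_cover_balls (half_pos hε)
  refine ⟨htf.toFinset.card + 1, by omega, fun y hy => ?_⟩
  have : ∀ i, ∃ z, i < htf.toFinset.card + 1 → z ∈ t ∧ dist (y i) z < ε/2 := by
    intro i
    by_cases hi : i < htf.toFinset.card + 1
    · have := htc (show y i ∈ Metric.closedBall 0 1 by simpa using hy i hi)
      simp only [Set.mem_iUnion, Metric.mem_ball, exists_prop] at this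
      obtain ⟨z, hz⟩ := this
      exact ⟨z, fun _ => hz⟩
    · exact ⟨0, fun h => absurd h hi⟩
  choose z hz using this
  obtain ⟨i, hi, j, hj, hij, he⟩ := Finset.exists_ne_map_eq_of_card_lt_of_maps_to
    (s := Finset.range (htf.toFinset.card + 1)) (t := htf.toFinset) (f := z) (by simp)
    (fun i hi => by simpa using (hz i (by simpa using hi)).1)
  simp only [Finset.mem_range] at hi hj
  have hd : ∀ i j, i < htf.toFinset.card + 1 → j < htf.toFinset.card + 1 → z i = z j →
      ‖y j - y i‖ < ε := by
    intro i j hi hj he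
    have h1 := (hz i hi).2
    have h2 := (hz j hj).2
    rw [he] at h1
    rw [← dist_eq_norm]
    linarith [dist_triangle_right (y j) (y i) (z j)]
  rcases lt_or_gt_of_ne hij with h | h
  · exact ⟨i, j, h, hj, hd i j hi hj he⟩
  · exact ⟨j, i, h, hi, hd j i hj hi he.symm⟩

lemma num_sum (R : ℕ → ℝ) (P : ℕ) (hP : 1 ≤ P) (hm : Monotone R) (h0 : ∀ i, 0 ≤ R i) (r : ℕ)
    (hd : ∀ q, q + P ≤ r → 2 * R q ≤ R (q + P)) :
    ∑ q ∈ Finset.range r, R (q+1) ≤ 2 * P * R r := by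
  induction r using Nat.strong_induction_on with
  | _ r ih =>
    have hP' : (1:ℝ) ≤ P := by exact_mod_cast hP
    rcases lt_or_ge r P with h | h
    · have h1 : ∑ q ∈ Finset.range r, R (q+1) ≤ (Finset.range r).card • R r :=
        Finset.sum_le_card_nsmul _ _ _ fun q hq => hm (by simp at hq; omega)
      rw [nsmul_eq_mul, Finset.card_range] at h1
      have : (r:ℝ) * R r ≤ P * R r := mul_le_mul_of_nonneg_right (by exact_mod_cast h.le) (h0 r)
      have := mul_nonneg (by linarith : (0:ℝ) ≤ P) (h0 r)
      linarith
    · obtain ⟨k, rfl⟩ := Nat.exists_eq_add_of_le' h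
      rw [Finset.sum_range_add]
      have h1 := ih k (by omega) (fun q hq => hd q (by omega))
      have h2 : ∑ q ∈ Finset.range P, R (k+q+1) ≤ (Finset.range P).card • R (k+P) :=
        Finset.sum_le_card_nsmul _ _ _ fun q hq => hm (by simp at hq; omega)
      rw [nsmul_eq_mul, Finset.card_range] at h2
      have h3 := mul_le_mul_of_nonneg_left (hd k le_rfl) (by linarith : (0:ℝ) ≤ P)
      linarith

/-- maximal projected displacement -/
noncomputable def Smax (x : ℕ → E) (Y : E →ₗ[ℝ] E) (a z : ℕ) : ℝ :=
  ((Finset.Icc a z).sup (fun t => ‖Y (x t - x a)‖₊) : NNReal)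

lemma le_Smax (x : ℕ → E) (Y : E →ₗ[ℝ] E) {a z t : ℕ} (h1 : a ≤ t) (h2 : t ≤ z) :
    ‖Y (x t - x a)‖ ≤ Smax x Y a z := by
  have := Finset.le_sup (f := fun t => ‖Y (x t - x a)‖₊) (Finset.mem_Icc.2 ⟨h1, h2⟩)
  exact_mod_cast this

lemma Smax_attain (x : ℕ → E) (Y : E →ₗ[ℝ] E) {a z : ℕ} (h : a ≤ z) :
    ∃ t, a ≤ t ∧ t ≤ z ∧ ‖Y (x t - x a)‖ = Smax x Y a z := by
  obtain ⟨t, ht, he⟩ := Finset.exists_mem_eq_sup (Finset.Icc a z) ⟨a, by simp [h]⟩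
    (fun t => ‖Y (x t - x a)‖₊)
  rw [Finset.mem_Icc] at ht
  refine ⟨t, ht.1, ht.2, ?_⟩
  rw [Smax, he]; rfl

lemma Smax_mono (x : ℕ → E) (Y : E →ₗ[ℝ] E) (a : ℕ) : Monotone (Smax x Y a) := by
  intro z z' h
  have := Finset.sup_mono (f := fun t => ‖Y (x t - x a)‖₊) (Finset.Icc_subset_Icc (le_refl a) h)
  exact_mod_cast this

lemma Smax_nonneg (x : ℕ → E) (Y : E →ₗ[ℝ] E) (a z : ℕ) : 0 ≤ Smax x Y a z := NNReal.coe_nonneg _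

lemma Smax_self (x : ℕ → E) (Y : E →ₗ[ℝ] E) (a : ℕ) : Smax x Y a a = 0 := by
  simp [Smax]

open Classical in
/-- next block end -/
noncomputable def nxt (p : ℕ → E) (B : Finset E) (τ : ℝ) (b0 a : ℕ) : ℕ :=
  if h : ∃ b, b ≤ b0 ∧ Vis p B τ a b then Nat.find h else a + b0 + 1

section blocks
variable {p : ℕ → E} {B : Finset E} {τ : ℝ} {b0 a : ℕ}

lemma nxt_vis (h : nxt p B τ b0 a ≤ b0) : Vis p B τ a (nxt p B τ b0 a) := by
  classical
  unfold nxt at h ⊢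
  split_ifs at h ⊢ with hh
  · exact (Nat.find_spec hh).2
  · omega

lemma nxt_le {b : ℕ} (hb : b ≤ b0) (hV : Vis p B τ a b) : nxt p B τ b0 a ≤ b := by
  classical
  have hh : ∃ b, b ≤ b0 ∧ Vis p B τ a b := ⟨b, hb, hV⟩
  unfold nxt
  rw [dif_pos hh]
  exact Nat.find_min' hh ⟨hb, hV⟩

lemma lt_nxt (hB : B.Nonempty) : a < nxt p B τ b0 a := by
  classical
  by_cases hh : ∃ b, b ≤ b0 ∧ Vis p B τ a b
  · unfold nxt
    rw [dif_pos hh]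
    obtain ⟨β, hβ⟩ := hB
    obtain ⟨t, h1, h2, -⟩ := (Nat.find_spec hh).2 β hβ
    omega
  · unfold nxt
    rw [dif_neg hh]; omega
end blocks

section win
variable {x n p : ℕ → E} {Y : E →ₗ[ℝ] E} {N : Set E} {a0 b0 : ℕ} {t1 c : ℝ} {B : Finset E} {τ Λ : ℝ}

lemma block_not (h : Base x n c) (hM : MinProp x n p N a0 b0 Λ τ)
    (hBN : ∀ β ∈ B, β ∈ N) (hB : B.Nonempty) (hΛ : 1 ≤ Λ) {a : ℕ} (ha : a0 ≤ a)
    (hc : nxt p B τ b0 a ≤ b0) :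
    ¬ CurveSys x n a (nxt p B τ b0 a) ((lam x (nxt p B τ b0 a) - lam x a)/(4*Λ)) := by
  intro hC
  have hlt := lt_nxt (p := p) (τ := τ) (b0 := b0) (a := a) hB
  obtain ⟨k, hk⟩ := Nat.exists_eq_add_of_lt hlt
  have hk' : nxt p B τ b0 a = (a+k)+1 := hk
  set b := nxt p B τ b0 a with hb
  set D := (lam x b - lam x a)/(4*Λ) with hD
  have hDe : lam x b - lam x a = 4 * Λ * D := by rw [hD]; field_simp
  have hst := hC.step (a+k) (by omega) (by omega)
  have hV : Vis p B τ a (a+k) := by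
    intro β hβ
    refine hM a (a+k) D ha (by omega) (hC.mono le_rfl (by omega) le_rfl) ?_ β (hBN β hβ)
    rw [hk', lam_succ] at hDe
    nlinarith [hC.pos]
  have := nxt_le (b0 := b0) (by omega) hV
  omega

lemma block_len (h : Base x n c) (hM : MinProp x n p N a0 b0 Λ τ)
    (hBN : ∀ β ∈ B, β ∈ N) (hB : B.Nonempty) (hΛ : 1 ≤ Λ) {a : ℕ} (ha : a0 ≤ a)
    (hc : nxt p B τ b0 a ≤ b0) {D : ℝ} (hD : CurveSys x n a0 b0 D) :
    lam x (nxt p B τ b0 a) - lam x a ≤ 4 * Λ * D := by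
  by_contra hcon
  push Not at hcon
  refine block_not h hM hBN hB hΛ ha hc (hD.mono ha hc ?_)
  rw [le_div_iff₀ (by linarith)]; linarith

lemma incomplete_len (hM : MinProp x n p N a0 b0 Λ τ)
    (hBN : ∀ β ∈ B, β ∈ N) {z : ℕ} (ha : a0 ≤ z)
    (hc : b0 < nxt p B τ b0 z) {D : ℝ} (hD : CurveSys x n a0 b0 D) :
    lam x b0 - lam x z < Λ * D := by
  by_contra hcon
  push Not at hcon
  have hV : Vis p B τ z b0 := fun β hβ =>
    hM z b0 D ha le_rfl (hD.mono ha le_rfl le_rfl) hcon β (hBN β hβ)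
  have := nxt_le le_rfl hV
  omega

lemma block_drop (h : Base x n c) (hM : MinProp x n p N a0 b0 Λ τ)
    (hBN : ∀ β ∈ B, β ∈ N) (hB : B.Nonempty) (hΛ : 1 ≤ Λ) {a : ℕ} (ha : a0 ≤ a)
    (hc : nxt p B τ b0 a ≤ b0) :
    ∃ i j, a ≤ i ∧ i < nxt p B τ b0 a ∧ a ≤ j ∧ j < nxt p B τ b0 a ∧
      ∀ z, nxt p B τ b0 a ≤ z →
        ⟪n i, x z - x j⟫ ≤ -(c/(4*Λ) * (lam x (nxt p B τ b0 a) - lam x a)) := by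
  have hlt := h.lam_lt (lt_nxt (p := p) (τ := τ) (b0 := b0) (a := a) hB)
  obtain ⟨i, j, h1, h2, h3, h4, h5⟩ := h.drop (by apply div_pos <;> linarith)
    (block_not h hM hBN hB hΛ ha hc)
  refine ⟨i, j, h1, h2, h3, h4, fun z hz => (h5 z hz).trans_eq ?_⟩
  ring

end win
end DB

namespace DB
set_option linter.unusedSectionVars false
set_option linter.unusedVariables false
variable {E : Type*} [NormedAddCommGroup E] [InnerProductSpace ℝ E]

section win
variable {x n p : ℕ → E} {Y : E →ₗ[ℝ] E} {N : Set E} {a0 b0 : ℕ} {t1 c : ℝ} {B : Finset E} {τ Λ : ℝ}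

lemma Y_le_two {a z i j : ℕ} (hi : a ≤ i) (hiz : i ≤ z) (hj : a ≤ j) (hjz : j ≤ z) :
    ‖Y (x i - x j)‖ ≤ 2 * Smax x Y a z := by
  have : x i - x j = (x i - x a) - (x j - x a) := by abel
  rw [this, map_sub]
  have := norm_sub_le (Y (x i - x a)) (Y (x j - x a))
  linarith [le_Smax x Y hi hiz, le_Smax x Y hj hjz]

lemma walk (w : Win x n p Y N a0 b0 t1) (h : Base x n c) (hM : MinProp x n p N a0 b0 Λ τ)
    (hBN : ∀ β ∈ B, β ∈ N) (hB : B.Nonempty) (hΛ : 1 ≤ Λ) {K g C : ℝ} {P : ℕ} (hK : 0 < K)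
    (hg : g = c / (4*Λ)) (hP : 1 ≤ P)
    (hpack : ∀ y : ℕ → E, (∀ i < P, ‖y i‖ ≤ 1) → ∃ i j, i < j ∧ j < P ∧ ‖y j - y i‖ < g/(8*K))
    (ht1 : t1 ≤ g/2) (ht1' : t1 * (8 * P / g) ≤ g/(4*K)) (hC : C = 8 * P / g)
    {a : ℕ} (ha : a0 ≤ a) (hc : nxt p B τ b0 a ≤ b0) :
    ∃ z, nxt p B τ b0 a ≤ z ∧ z ≤ b0 ∧
      lam x z - lam x a ≤ C * max (K * (lam x (nxt p B τ b0 a) - lam x a)) (Smax x Y a z) ∧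
      (b0 < nxt p B τ b0 z ∨ lam x (nxt p B τ b0 z) - lam x z ≤
        max (K * (lam x (nxt p B τ b0 a) - lam x a)) (Smax x Y a z) / (2*K)) := by
  classical
  have hg0 : 0 < g := by rw [hg]; have := h.cpos; positivity
  set f := nxt p B τ b0 with hf
  set s0 := lam x (f a) - lam x a with hs0
  have hs0pos : 0 < s0 := by have := h.lam_lt (lt_nxt (p := p) (τ := τ) (b0 := b0) (a := a) hB); linarith
  set R : ℕ → ℝ := fun z => max (K * s0) (Smax x Y a z) with hR
  have hRm : Monotone R := fun z z' hz => max_le_max le_rfl (Smax_mono x Y a hz)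
  have hRpos : ∀ z, 0 < R z := fun z => lt_of_lt_of_le (mul_pos hK hs0pos) (le_max_left _ _)
  have hSR : ∀ z, Smax x Y a z ≤ R z := fun z => le_max_right _ _
  set u : ℕ → ℕ := fun r => f^[r] a with hu
  have hu0 : u 0 = a := rfl
  have hus : ∀ r, u (r+1) = f (u r) := fun r => Function.iterate_succ_apply' f r a
  have humono : StrictMono u := strictMono_nat_of_lt_succ fun r => by rw [hus]; exact lt_nxt hB
  have hau : ∀ r, a ≤ u r := fun r => by rw [← hu0]; exact humono.monotone (Nat.zero_le r)
  set halt : ℕ → Prop := fun r => 1 ≤ r ∧ (b0 < f (u r) ∨ lam x (f (u r)) - lam x (u r) ≤ R (u r) / (2*K))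
    with hhalt
  have hex : ∃ r, halt r := by
    refine ⟨b0+1, by omega, Or.inl ?_⟩
    rw [← hus]
    have := humono.id_le (b0+1+1)
    simp only [id] at this
    omega
  obtain ⟨r, hr, hmin⟩ : ∃ r, halt r ∧ ∀ q < r, ¬ halt q :=
    ⟨Nat.find hex, Nat.find_spec hex, fun q hq => Nat.find_min hex hq⟩
  have hns : ∀ q < r, u (q+1) ≤ b0 ∧ R (u q) / (2*K) < lam x (u (q+1)) - lam x (u q) := by
    intro q hq
    rcases Nat.eq_zero_or_pos q with rfl | hq0
    · rw [hus, hu0]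
      refine ⟨hc, ?_⟩
      have : R a = K * s0 := by
        simp only [hR, Smax_self]; exact max_eq_left (mul_pos hK hs0pos).le
      rw [this, div_lt_iff₀ (by positivity)]
      nlinarith [mul_pos hK hs0pos]
    · have := hmin q hq
      simp only [hhalt, not_and, not_or, not_lt, not_le] at this
      rw [hus]
      exact this hq0
  have hur : u r ≤ b0 := by
    obtain ⟨k, rfl⟩ := Nat.exists_eq_add_of_le' hr.1
    exact (hns k (by omega)).1
  have hdrop : ∀ q, ∃ i j, q < r → u q ≤ i ∧ i < u (q+1) ∧ u q ≤ j ∧ j < u (q+1) ∧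
      ∀ z, u (q+1) ≤ z → ⟪n i, x z - x j⟫ ≤ -(g * (lam x (u (q+1)) - lam x (u q))) := by
    intro q
    by_cases hq : q < r
    · have := (hns q hq).1
      rw [hus] at this
      obtain ⟨i, j, h1, h2, h3, h4, h5⟩ := block_drop h hM hBN hB hΛ (ha.trans (hau q)) this
      refine ⟨i, j, fun _ => ?_⟩
      rw [hus, hg]
      exact ⟨h1, h2, h3, h4, h5⟩
    · exact ⟨0, 0, fun h => absurd h hq⟩
  choose I J hIJ using hdrop
  have hs : ∀ q < r, lam x (u (q+1)) - lam x (u q) ≤ 4/g * R (u (q+1)) := by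
    intro q hq
    obtain ⟨h1, h2, h3, h4, h5⟩ := hIJ q hq
    have e1 := h5 _ le_rfl
    have hb := (hns q hq).1
    have e2 := (abs_le.1 (w.B2 (t := I q) (by have := hau q; omega) (by omega)
      (x (u (q+1)) - x (J q)))).1
    have e3 : t1 * ‖x (u (q+1)) - x (J q)‖ ≤ g/2 * (lam x (u (q+1)) - lam x (u q)) :=
      mul_le_mul ht1 (norm_le_lam2 x h3 h4.le (by omega) le_rfl) (norm_nonneg _) (by positivity)
    have e4 : ‖Y (x (u (q+1)) - x (J q))‖ ≤ 2 * Smax x Y a (u (q+1)) :=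
      Y_le_two (hau _) le_rfl ((hau q).trans h3) h4.le
    have e5 := hSR (u (q+1))
    rw [div_mul_eq_mul_div, le_div_iff₀ hg0]
    linarith
  have htel : ∀ q k, lam x (u (q+k)) - lam x (u q) =
      ∑ l ∈ Finset.range k, (lam x (u (q+l+1)) - lam x (u (q+l))) := by
    intro q k
    exact (Finset.sum_range_sub (fun l => lam x (u (q+l))) k).symm
  have hdouble : ∀ q, q + P ≤ r → 2 * R (u q) ≤ R (u (q+P)) := by
    intro q hqr
    by_contra hcon
    push Not at hcon
    have hRq := hRpos (u q)
    have hlen : lam x (u (q+P)) - lam x (u q) ≤ 8 * P / g * R (u q) := by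
      rw [htel]
      have : ∑ l ∈ Finset.range P, (lam x (u (q+l+1)) - lam x (u (q+l))) ≤
          (Finset.range P).card • (4/g * (2 * R (u q))) := by
        apply Finset.sum_le_card_nsmul
        intro l hl
        rw [Finset.mem_range] at hl
        refine (hs (q+l) (by omega)).trans ?_
        have : R (u (q+l+1)) ≤ R (u (q+P)) := hRm (humono.monotone (by omega))
        apply mul_le_mul_of_nonneg_left (by linarith) (by positivity)
      refine this.trans_eq ?_
      rw [nsmul_eq_mul, Finset.card_range]; ring
    obtain ⟨i, j, hij, hjP, hlt⟩ := hpack (fun l => (2 * R (u q))⁻¹ • Y (x (J (q+l)) - x a)) (by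
      intro l hl
      obtain ⟨h1, h2, h3, h4, h5⟩ := hIJ (q+l) (by omega)
      rw [norm_smul, norm_inv, Real.norm_of_nonneg (by positivity), inv_mul_le_iff₀ (by positivity)]
      have e1 : ‖Y (x (J (q+l)) - x a)‖ ≤ R (u (q+P)) :=
        (le_Smax x Y ((hau _).trans h3) (h4.le.trans (humono.monotone (by omega)))).trans (hSR _)
      linarith)
    rw [← smul_sub, ← map_sub, norm_smul, norm_inv, Real.norm_of_nonneg (by positivity),
      inv_mul_lt_iff₀ (by positivity), sub_sub_sub_cancel_right] at hlt
    obtain ⟨h1, h2, h3, h4, h5⟩ := hIJ (q+i) (by omega)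
    obtain ⟨k1, k2, k3, k4, k5⟩ := hIJ (q+j) (by omega)
    have l1 : u (q+i+1) ≤ u (q+j) := humono.monotone (by omega)
    have l2 : u q ≤ u (q+i) := humono.monotone (by omega)
    have l3 : u (q+j+1) ≤ u (q+P) := humono.monotone (by omega)
    have l4 : u (q+P) ≤ b0 := (humono.monotone hqr).trans hur
    have e1 := h5 (J (q+j)) (by omega)
    have e2 := (abs_le.1 (w.B2 (t := I (q+i)) (by have := hau q; omega) (by omega)
      (x (J (q+j)) - x (J (q+i))))).1
    have e3 : t1 * ‖x (J (q+j)) - x (J (q+i))‖ ≤ t1 * (8 * P / g * R (u q)) :=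
      mul_le_mul_of_nonneg_left ((norm_le_lam2 x (a := u q) (b := u (q+P)) (by omega) (by omega)
        (by omega) (by omega)).trans hlen) w.t1nn
    have e4 : t1 * (8 * P / g * R (u q)) ≤ g/(4*K) * R (u q) := by
      rw [← mul_assoc]; exact mul_le_mul_of_nonneg_right ht1' hRq.le
    have e5 : R (u q) / (2*K) < lam x (u (q+i+1)) - lam x (u (q+i)) :=
      lt_of_le_of_lt (div_le_div_of_nonneg_right (hRm l2) (by positivity)) (hns (q+i) (by omega)).2
    have e6 := mul_lt_mul_of_pos_left e5 hg0
    have e7 : g * (R (u q) / (2*K)) = 2 * (g/(4*K) * R (u q)) := by field_simp; norm_num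
    have e8 : 2 * R (u q) * (g / (8*K)) = g/(4*K) * R (u q) := by field_simp; norm_num
    linarith
  refine ⟨u r, ?_, hur, ?_, hr.2⟩
  · have : u 1 ≤ u r := humono.monotone hr.1
    rwa [hus, hu0] at this
  · have e := htel 0 r
    simp only [zero_add, hu0] at e
    rw [e]
    have e1 : ∑ l ∈ Finset.range r, (lam x (u (l+1)) - lam x (u l)) ≤
        ∑ l ∈ Finset.range r, 4/g * R (u (l+1)) :=
      Finset.sum_le_sum fun l hl => hs l (Finset.mem_range.1 hl)
    rw [← Finset.mul_sum] at e1
    have e2 := num_sum (fun q => R (u q)) P hP (hRm.comp humono.monotone) (fun i => (hRpos _).le) r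
      hdouble
    have e3 := mul_le_mul_of_nonneg_left e2 (by positivity : 0 ≤ 4/g)
    refine (e1.trans e3).trans_eq ?_
    rw [hC]
    simp only [hR]
    ring

end win
end DB

namespace DB
set_option linter.unusedSectionVars false
set_option linter.unusedVariables false
variable {E : Type*} [NormedAddCommGroup E] [InnerProductSpace ℝ E]

section win
variable {x n p : ℕ → E} {Y : E →ₗ[ℝ] E} {N : Set E} {a0 b0 : ℕ} {t1 c : ℝ} {B : Finset E} {τ Λ : ℝ}

lemma window_contra (w : Win x n p Y N a0 b0 t1) (h : Base x n c) (hM : MinProp x n p N a0 b0 Λ τ)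
    {θ τ' τ2 ω ρ K Λ2 g C c'' A B0 hh E0 Lb D : ℝ} {P : ℕ}
    (hM2 : MinProp x n p N a0 b0 Λ2 τ2)
    (hBN : ∀ β ∈ B, β ∈ N) (hB : B.Nonempty) (hnet : ∀ q ∈ N, ∃ β ∈ B, ‖q - β‖ ≤ ρ)
    (hθ : 0 < θ) (hθY : ∀ v, ∃ q ∈ N, θ * ‖Y v‖ ≤ |⟪q, Y v⟫|)
    (hτ0 : 0 ≤ τ) (hτ : τ ≤ θ/16) (hτ'0 : 0 < τ') (hτ' : τ' ≤ θ/16) (hτ2 : τ2 ≤ θ/16) (hω0 : 0 < ω)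
    (hω1 : ω ≤ 1) (hω : ω ≤ θ/16) (hρ0 : 0 ≤ ρ) (hρ : ρ ≤ θ/16) (hτ'ω : τ' ≤ ω)
    (hΛ2 : Λ2 * τ' ≤ ω) (hK : 16 ≤ θ * K) (hK0 : 0 < K)
    (hρ2 : ρ ≤ c * τ' / 8) (hK2 : 24 * B.card ≤ c * τ' * K) (hτ3 : B.card * τ ≤ c * τ' / 16)
    (hτK : τ * K ≤ 1)
    (hΛ : 1 ≤ Λ) (hg : g = c / (4*Λ)) (hP : 1 ≤ P)
    (hpack : ∀ y : ℕ → E, (∀ i < P, ‖y i‖ ≤ 1) → ∃ i j, i < j ∧ j < P ∧ ‖y j - y i‖ < g/(8*K))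
    (hC : C = 8 * P / g) (hc'' : c'' = c * τ' / 4) (hK3 : 6 * B.card ≤ c'' * K)
    (hA : A = 4 * C / c'') (hB0 : B0 = 2 * C * K + 6 * B.card * A)
    (hh1 : 4 * K * Λ ≤ hh) (hh2 : 1 ≤ hh * τ') (hh3 : 1 ≤ hh) (hE0 : E0 = C * hh + Λ)
    (hLb : A * (B.card * hh) + 4 * B0 * Λ + E0 < Lb) (hLbΛ : Λ ≤ Lb)
    (ht1 : t1 ≤ g/2) (ht2 : t1 * (8 * P / g) ≤ g/(4*K))
    (ht3 : t1 * C ≤ θ/16) (ht4 : (B.card + 1) * (t1 * C) ≤ c * τ' / 8) (ht5 : t1 * (C * K) ≤ 1)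
    (ht6 : t1 * (Lb + 1) ≤ θ/16)
    (hD : CurveSys x n a0 b0 D) (ha0 : a0 ≤ b0) (hL1 : Lb * D ≤ lam x b0 - lam x a0)
    (hL2 : lam x b0 - lam x a0 ≤ (Lb + 1) * D) : False := by
  have hDp := hD.pos
  have hg0 : 0 < g := by rw [hg]; have := h.cpos; positivity
  have hC0 : 0 < C := by
    rw [hC]; have : (0:ℝ) < P := by exact_mod_cast hP
    positivity
  have hc0 : 0 < c'' := by rw [hc'']; have := h.cpos; positivity
  have hA0 : 0 < A := by rw [hA]; positivity
  have hN0 : (0:ℝ) ≤ B.card := Nat.cast_nonneg _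
  have hB00 : 0 < B0 := by rw [hB0]; positivity
  have hE00 : 0 < E0 := by rw [hE0]; positivity
  set f := nxt p B τ b0 with hf
  set m := ∑ β ∈ B, β with hm
  set s : ℕ → ℝ := fun a => lam x (f a) - lam x a with hs
  have hspos : ∀ a, 0 < s a := fun a => by
    have := h.lam_lt (lt_nxt (p := p) (τ := τ) (b0 := b0) (a := a) hB); simp only [hs]; linarith
  have hslen : ∀ a, a0 ≤ a → f a ≤ b0 → s a ≤ 4 * Λ * D := fun a h1 h2 =>
    block_len h hM hBN hB hΛ h1 h2 hD
  have hfa : ∀ a, a < f a := fun a => lt_nxt hB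
  have li : ∀ a b, a0 ≤ a → f a ≤ b → b ≤ b0 → K * s a ≤ Smax x Y a b →
      t1 * (lam x b - lam x a) ≤ θ/16 * Smax x Y a b → ¬ CurveSys x n a b (τ' * Smax x Y a b) := by
    intro a b h1 h2 h3 h4 h5
    have hS0 : 0 < Smax x Y a b := lt_of_lt_of_le (mul_pos hK0 (hspos a)) h4
    exact lem_i w h hBN hnet hθ hθY hM2 hτ hτ'0 hτ' hτ2 hω0 hω1 hω hρ hτ'ω hΛ2 hK h1 (hfa a).le h2 h3
      (nxt_vis (h2.trans h3)) hS0 (fun t k1 k2 => le_Smax x Y k1 k2)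
      (Smax_attain x Y ((hfa a).le.trans h2)) h4 h5
  have hca0 : f a0 ≤ b0 := by
    by_contra hcon
    push Not at hcon
    have := incomplete_len hM hBN le_rfl hcon hD
    have := mul_le_mul_of_nonneg_right hLbΛ hDp.le
    linarith
  have hSD : Smax x Y a0 b0 ≤ hh * D := by
    by_contra hcon
    push Not at hcon
    have h1 : D ≤ Smax x Y a0 b0 := by nlinarith
    refine li a0 b0 le_rfl hca0 le_rfl ?_ ?_ (hD.mono le_rfl le_rfl ?_)
    · have := mul_le_mul_of_nonneg_left (hslen a0 le_rfl hca0) hK0.le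
      have := mul_le_mul_of_nonneg_right hh1 hDp.le
      linarith
    · have e1 := mul_le_mul_of_nonneg_left hL2 w.t1nn
      have e2 := mul_le_mul_of_nonneg_right ht6 hDp.le
      have e3 := mul_le_mul_of_nonneg_left h1 (by positivity : 0 ≤ θ/16)
      linarith
    · have e1 := mul_le_mul_of_nonneg_left hcon.le hτ'0.le
      have e2 := mul_le_mul_of_nonneg_right hh2 hDp.le
      linarith
  set μ := ⟪m, x a0⟫ - B.card * (hh * D) with hμ
  have hμle : ∀ t, a0 ≤ t → t ≤ b0 → μ ≤ ⟪m, x t⟫ := by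
    intro t h1 h2
    have e1 : -(B.card * (hh * D)) ≤ ⟪m, x t - x a0⟫ := by
      rw [hm, sum_inner, ← mul_neg, ← nsmul_eq_mul]
      apply Finset.card_nsmul_le_sum
      intro β hβ
      have := (abs_le.1 (abs_real_inner_le_norm β (Y (x t - x a0)))).1
      rw [← w.Yin β (hBN β hβ), w.nunit β (hBN β hβ), one_mul] at this
      have := le_Smax x Y h1 h2
      linarith
    rw [inner_sub_right] at e1
    linarith
  have main : ∀ k a, b0 - a = k → a0 ≤ a → f a ≤ b0 →
      lam x b0 - lam x a ≤ A * (⟪m, x a⟫ - μ) + B0 * s a + E0 * D := by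
    intro k
    induction k using Nat.strong_induction_on with
    | _ k ih =>
      intro a hk ha hc
      obtain ⟨z, hz1, hz2, hz3, hz4⟩ := walk w h hM hBN hB hΛ hK0 hg hP hpack ht1 ht2 hC ha hc
      change f a ≤ z at hz1
      have haz : a < z := (hfa a).trans_le hz1
      change _ ≤ C * max (K * s a) (Smax x Y a z) at hz3
      change b0 < f z ∨ s z ≤ max (K * s a) (Smax x Y a z) / (2*K) at hz4
      set S := Smax x Y a z with hS
      have hsa := hspos a
      have hT0 := lam_mono x haz.le
      have charged : K * s a ≤ S → t1 * (lam x z - lam x a) ≤ t1 * C * S ∧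
          ¬ CurveSys x n a z (τ' * S) := by
        intro hcase
        rw [max_eq_right hcase] at hz3
        have hS0 : 0 < S := lt_of_lt_of_le (mul_pos hK0 hsa) hcase
        have e1 : t1 * (lam x z - lam x a) ≤ t1 * C * S := by
          rw [mul_assoc]; exact mul_le_mul_of_nonneg_left hz3 w.t1nn
        exact ⟨e1, li a z ha hz1 hz2 hcase (e1.trans (mul_le_mul_of_nonneg_right ht3 hS0.le))⟩
      by_cases hcz : f z ≤ b0
      · have hz4 := hz4.resolve_left (by omega)
        have ihz := ih (b0 - z) (by omega) z rfl (by omega) hcz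
        rw [le_div_iff₀ (by positivity)] at hz4
        rcases le_or_gt (K * s a) S with hcase | hcase
        · obtain ⟨c1, c2⟩ := charged hcase
          rw [max_eq_right hcase] at hz3 hz4
          have hS0 : 0 < S := lt_of_lt_of_le (mul_pos hK0 hsa) hcase
          have c3 := lem_ii w h hBN hnet hτ'0 hτ0 hρ0 hρ2 hK0 hK2 hτ3 ha (hfa a).le hz1 hz2
            (nxt_vis hc) hS0 (fun t k1 k2 => le_Smax x Y k1 k2) hcase
            (by
              have e1 := mul_le_mul_of_nonneg_left c1 (by positivity : (0:ℝ) ≤ B.card + 1)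
              have e2 := mul_le_mul_of_nonneg_right ht4 hS0.le
              linarith) c2
          rw [← hc'', inner_sub_right] at c3
          have k1 : A * c'' = 4 * C := by rw [hA]; field_simp
          have k2 : B0 ≤ 6 * C * K := by
            have e := mul_le_mul_of_nonneg_right hK3 hA0.le
            have : c'' * K * A = 4 * C * K := by rw [← k1]; ring
            rw [hB0]; linarith
          have k3 : B0 * s z ≤ 3 * C * S := by
            have e1 := mul_le_mul_of_nonneg_right k2 (hspos z).le
            have e2 := mul_le_mul_of_nonneg_left hz4 hC0.le
            linarith
          have k4 := mul_le_mul_of_nonneg_left c3 hA0.le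
          have k5 : A * (c'' * S) = 4 * C * S := by rw [← mul_assoc, k1]
          have k6 := mul_pos hB00 hsa
          linarith
        · rw [max_eq_left hcase.le] at hz3 hz4
          have c3 := lem_small w h hBN ha hc haz.le (nxt_vis hc) ((le_Smax x Y haz.le le_rfl).trans hcase.le)
            hz3
          change _ ≤ (B.card:ℝ) * (s a + _ + _) at c3
          have e1 : τ * (K * s a) ≤ s a := by
            rw [← mul_assoc]; have := mul_le_mul_of_nonneg_right hτK hsa.le; linarith
          have e2 : t1 * (C * (K * s a)) ≤ s a := by
            have := mul_le_mul_of_nonneg_right ht5 hsa.le; linarith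
          have e3 : (B.card:ℝ) * (s a + τ * (K * s a) + t1 * (C * (K * s a))) ≤ B.card * (3 * s a) :=
            mul_le_mul_of_nonneg_left (by linarith) hN0
          have c4 : ⟪m, x z - x a⟫ ≤ B.card * (3 * s a) := c3.trans e3
          rw [inner_sub_right] at c4
          have k4 := mul_le_mul_of_nonneg_left c4 hA0.le
          have k5 : s z ≤ s a / 2 := by
            by_contra hcon
            push Not at hcon
            have := mul_lt_mul_of_pos_left hcon hK0
            linarith
          have k6 := mul_le_mul_of_nonneg_left k5 hB00.le
          have k7 : B0 * s a = 2 * (C * (K * s a)) + 2 * (A * (B.card * (3 * s a))) := by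
            rw [hB0]; ring
          linarith
      · have hR : max (K * s a) S ≤ hh * D := by
          apply max_le
          · have := mul_le_mul_of_nonneg_left (hslen a ha hc) hK0.le
            have := mul_le_mul_of_nonneg_right hh1 hDp.le
            linarith
          · rcases le_or_gt (K * s a) S with hcase | hcase
            · by_contra hcon
              push Not at hcon
              refine (charged hcase).2 (hD.mono ha hz2 ?_)
              have e1 := mul_le_mul_of_nonneg_left hcon.le hτ'0.le
              have e2 := mul_le_mul_of_nonneg_right hh2 hDp.le
              linarith
            · have := mul_le_mul_of_nonneg_left (hslen a ha hc) hK0.le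
              have := mul_le_mul_of_nonneg_right hh1 hDp.le
              linarith
        have e1 := incomplete_len hM hBN (by omega : a0 ≤ z) (not_le.1 hcz) hD
        have e2 := mul_le_mul_of_nonneg_left hR hC0.le
        have e3 : 0 ≤ A * (⟪m, x a⟫ - μ) :=
          mul_nonneg hA0.le (by linarith [hμle a ha (by omega)])
        have e4 := mul_pos hB00 hsa
        rw [hE0]
        linarith
  have fin := main _ a0 rfl le_rfl hca0
  have e1 : A * (⟪m, x a0⟫ - μ) = A * (B.card * hh) * D := by rw [hμ]; ring
  have e2 := mul_le_mul_of_nonneg_left (hslen a0 le_rfl hca0) hB00.le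
  have e3 := mul_lt_mul_of_pos_right hLb hDp
  linarith

end win
end DB

namespace DB
set_option linter.unusedSectionVars false
set_option linter.unusedVariables false
variable {E : Type*} [NormedAddCommGroup E] [InnerProductSpace ℝ E]

def NearW (n : ℕ → E) (N : Set E) (a b : ℕ) (τ : ℝ) : Prop :=
  ∀ i, a ≤ i → i < b → ∃ p ∈ N, ‖n i - p‖ ≤ τ

def Ecal (x n : ℕ → E) (N : Set E) : Prop :=
  ∀ Λ τ : ℝ, 0 < τ → ∃ a b D, CurveSys x n a b D ∧ Λ * D ≤ lam x b - lam x a ∧ NearW n N a b τ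

lemma exists_min [FiniteDimensional ℝ E] {x n : ℕ → E}
    (h0 : Ecal x n (Metric.sphere 0 1)) :
    ∃ N : Set E, IsClosed N ∧ N ⊆ Metric.sphere 0 1 ∧ Ecal x n N ∧
      ∀ N', IsClosed N' → N' ⊆ N → Ecal x n N' → N' = N := by
  obtain ⟨m, -, hm⟩ := zorn_superset_nonempty
    {N : Set E | IsClosed N ∧ N ⊆ Metric.sphere 0 1 ∧ Ecal x n N} (by
      intro ch hch hchain hne
      refine ⟨⋂₀ ch, ⟨isClosed_sInter fun s hs => (hch hs).1, ?_, ?_⟩,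
        fun s hs => Set.sInter_subset_of_mem hs⟩
      · obtain ⟨s, hs⟩ := hne
        exact (Set.sInter_subset_of_mem hs).trans (hch hs).2.1
      · intro Λ τ hτ
        have : Nonempty ch := hne.to_subtype
        obtain ⟨V, hV⟩ := exists_subset_nhds_of_isCompact (ι := ch) (V := fun s => (s : Set E))
          (by
            intro s t
            rcases hchain.total s.2 t.2 with h | h
            · exact ⟨s, le_rfl, h⟩
            · exact ⟨t, h, le_rfl⟩)
          (fun s => (isCompact_sphere (0:E) 1).of_isClosed_subset (hch s.2).1 (hch s.2).2.1)
          (U := Metric.thickening (τ/2) (⋂₀ ch)) (by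
            intro y hy
            rw [← Set.sInter_eq_iInter] at hy
            exact Metric.isOpen_thickening.mem_nhds (Metric.self_subset_thickening (half_pos hτ) _ hy))
        obtain ⟨a, b, D, h1, h2, h3⟩ := (hch V.2).2.2 Λ (τ/2) (half_pos hτ)
        refine ⟨a, b, D, h1, h2, fun i hi hi2 => ?_⟩
        obtain ⟨p, hp, hp2⟩ := h3 i hi hi2
        obtain ⟨q, hq, hq2⟩ := Metric.mem_thickening_iff.1 (hV hp)
        refine ⟨q, hq, ?_⟩
        rw [dist_eq_norm] at hq2
        have : n i - q = (n i - p) + (p - q) := by abel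
        rw [this]
        linarith [norm_add_le (n i - p) (p - q)])
    (Metric.sphere 0 1) ⟨Metric.isClosed_sphere, le_rfl, h0⟩
  refine ⟨m, hm.1.1, hm.1.2.1, hm.1.2.2, fun N' h1 h2 h3 => ?_⟩
  exact Set.Subset.antisymm h2 (hm.2 ⟨h1, h2.trans hm.1.2.1, h3⟩ h2)

lemma min_visit [FiniteDimensional ℝ E] {x n : ℕ → E} {N : Set E} (hN : IsClosed N)
    (hNs : N ⊆ Metric.sphere 0 1)
    (hmin : ∀ N', IsClosed N' → N' ⊆ N → Ecal x n N' → N' = N) {τ : ℝ} (hτ : 0 < τ) :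
    ∃ Λ ts : ℝ, 1 ≤ Λ ∧ 0 < ts ∧ ∀ a b D, CurveSys x n a b D → Λ * D ≤ lam x b - lam x a →
      NearW n N a b ts → ∀ q ∈ N, ∃ i, a ≤ i ∧ i < b ∧ ‖n i - q‖ ≤ τ := by
  classical
  have hcomp : IsCompact N := (isCompact_sphere (0:E) 1).of_isClosed_subset hN hNs
  obtain ⟨t, htN, htf, htc⟩ := hcomp.finite_cover_balls (by positivity : 0 < τ/4)
  have hp : ∀ p, ∃ Λ ts : ℝ, p ∈ N → 0 < ts ∧ ∀ a b D, CurveSys x n a b D →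
      Λ * D ≤ lam x b - lam x a → ¬ NearW n (N \ Metric.ball p (τ/4)) a b ts := by
    intro p
    by_cases hpN : p ∈ N
    · have : ¬ Ecal x n (N \ Metric.ball p (τ/4)) := by
        intro hE
        have := hmin _ (hN.sdiff Metric.isOpen_ball) Set.diff_subset hE
        rw [← this] at hpN
        exact hpN.2 (Metric.mem_ball_self (by positivity))
      unfold Ecal at this
      push Not at this
      obtain ⟨Λ, ts, h1, h2⟩ := this
      exact ⟨Λ, ts, fun _ => ⟨h1, h2⟩⟩
    · exact ⟨0, 0, fun h => absurd h hpN⟩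
  choose L T hLT using hp
  obtain ⟨M1, hM1⟩ := (htf.image L).bddAbove
  obtain ⟨M2, hM2⟩ := (htf.image (fun p => (T p)⁻¹)).bddAbove
  refine ⟨max 1 M1, min (τ/4) (1/(|M2|+1)), le_max_left _ _, by positivity, ?_⟩
  intro a b D hC hlen hnear q hq
  obtain ⟨p, hp, hqp⟩ : ∃ p ∈ t, q ∈ Metric.ball p (τ/4) := by simpa using htc hq
  by_contra hcon
  push Not at hcon
  obtain ⟨hT0, hT⟩ := hLT p (htN hp)
  refine hT a b D hC ?_ ?_
  · refine le_trans (mul_le_mul_of_nonneg_right ?_ hC.pos.le) hlen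
    exact (hM1 (Set.mem_image_of_mem _ hp)).trans (le_max_right _ _)
  · intro i hi hib
    obtain ⟨r, hr, hr2⟩ := hnear i hi hib
    refine ⟨r, ⟨hr, fun hrb => ?_⟩, ?_⟩
    · have h1 := hcon i hi hib
      rw [Metric.mem_ball, dist_eq_norm] at hqp hrb
      have h2 := hr2.trans (min_le_left _ _)
      have : n i - q = (n i - r) + (r - p) - (q - p) := by abel
      rw [this] at h1
      linarith [norm_sub_le ((n i - r) + (r - p)) (q - p), norm_add_le (n i - r) (r - p)]
    · refine hr2.trans ((min_le_right _ _).trans ?_)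
      have h3 : (T p)⁻¹ ≤ M2 := hM2 (Set.mem_image_of_mem (fun p => (T p)⁻¹) hp)
      rw [one_div]
      apply inv_le_of_inv_le₀ hT0
      linarith [le_abs_self M2]

lemma theta [FiniteDimensional ℝ E] {N : Set E} (hne : N.Nonempty) :
    ∃ θ : ℝ, 0 < θ ∧ θ ≤ 1 ∧ ∀ u ∈ Submodule.span ℝ N, ∃ q ∈ N, θ * ‖u‖ ≤ |⟪q, u⟫| := by
  set U := Submodule.span ℝ N with hU
  have hK : IsCompact (Metric.sphere (0:E) 1 ∩ (U : Set E)) :=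
    (isCompact_sphere (0:E) 1).inter_right U.closed_of_finiteDimensional
  obtain ⟨k, hk⟩ := hK.elim_directed_cover
    (fun k : ℕ => ⋃ q ∈ N, {v : E | 1/((k:ℝ)+1) < |⟪q, v⟫|})
    (fun k => isOpen_biUnion fun q _ => isOpen_lt continuous_const (by fun_prop))
    (by
      rintro v ⟨hv1, hv2⟩
      by_contra hcon
      simp only [Set.mem_iUnion, Set.mem_setOf_eq, not_exists, not_lt] at hcon
      have h0 : ∀ q ∈ N, ⟪q, v⟫ = 0 := by
        intro q hq
        by_contra hne
        obtain ⟨k, hk⟩ := exists_nat_one_div_lt (abs_pos.2 hne)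
        exact absurd (hcon k q hq) (not_le.2 hk)
      have h1 : ∀ u ∈ U, ⟪u, v⟫ = 0 := by
        intro u hu
        induction hu using Submodule.span_induction with
        | mem y hy => exact h0 y hy
        | zero => simp
        | add y z _ _ h1 h2 => rw [inner_add_left, h1, h2, add_zero]
        | smul r y _ h1 => rw [inner_smul_left, h1, mul_zero]
      have := inner_self_eq_zero.1 (h1 v hv2)
      simp [this] at hv1)
    (by
      apply directed_of_isDirected_le
      intro i j hij v hv
      simp only [Set.mem_iUnion, Set.mem_setOf_eq] at hv ⊢
      obtain ⟨q, hq, h⟩ := hv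
      exact ⟨q, hq, lt_of_le_of_lt (Nat.one_div_le_one_div hij) h⟩)
  refine ⟨1/((k:ℝ)+1), by positivity, ?_, ?_⟩
  · rw [div_le_one (by positivity)]; linarith [(Nat.cast_nonneg k : (0:ℝ) ≤ k)]
  · intro u hu
    by_cases hu0 : u = 0
    · obtain ⟨q, hq⟩ := hne
      exact ⟨q, hq, by simp [hu0]⟩
    · have hpos : 0 < ‖u‖ := norm_pos_iff.2 hu0
      have := hk (show ‖u‖⁻¹ • u ∈ _ from ⟨by
        rw [mem_sphere_zero_iff_norm, norm_smul, norm_inv, norm_norm, inv_mul_cancel₀ hpos.ne'],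
        U.smul_mem _ hu⟩)
      simp only [Set.mem_iUnion, Set.mem_setOf_eq] at this
      obtain ⟨q, hq, h⟩ := this
      refine ⟨q, hq, ?_⟩
      rw [inner_smul_right, abs_mul, abs_of_pos (inv_pos.2 hpos), lt_inv_mul_iff₀ hpos] at h
      linarith

lemma ev_small {r : ℝ} (hr : 0 < r) (M : ℝ) : ∀ᶠ t in nhdsWithin (0:ℝ) (Set.Ioi 0), t * M ≤ r := by
  have : Tendsto (fun t : ℝ => t * M) (nhdsWithin 0 (Set.Ioi 0)) (nhds (0 * M)) :=
    ((continuous_id.mul continuous_const).tendsto 0).mono_left nhdsWithin_le_nhds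
  rw [zero_mul] at this
  exact (this.eventually (gt_mem_nhds hr)).mono fun t ht => ht.le

end DB

namespace DB
set_option linter.unusedSectionVars false
set_option linter.unusedVariables false
variable {E : Type*} [NormedAddCommGroup E] [InnerProductSpace ℝ E]

theorem curve_finite [FiniteDimensional ℝ E] {x n : ℕ → E} {c D0 : ℝ} (h : Base x n c)
    (hsys : ∀ b, CurveSys x n 0 b D0) : ∃ C, ∀ k, lam x k ≤ C := by
  classical
  by_contra hunb
  push Not at hunb
  have h0 : Ecal x n (Metric.sphere 0 1) := by
    intro Λ τ hτ
    obtain ⟨b, hb⟩ := hunb (Λ * D0)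
    refine ⟨0, b, D0, hsys b, ?_, fun i _ _ => ⟨n i, ?_, ?_⟩⟩
    · simp only [lam, Finset.range_zero, Finset.sum_empty, sub_zero] at hb ⊢
      exact hb.le
    · rw [mem_sphere_zero_iff_norm]; exact h.unit i
    · simpa using hτ.le
  obtain ⟨N, hNc, hNs, hNE, hmin⟩ := exists_min h0
  have hne : N.Nonempty := by
    obtain ⟨a, b, D, h1, h2, h3⟩ := hNE 1 1 one_pos
    have hab : a < b := by
      by_contra hcon
      have := lam_mono x (not_lt.1 hcon)
      linarith [h1.pos]
    obtain ⟨p, hp, -⟩ := h3 a le_rfl hab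
    exact ⟨p, hp⟩
  obtain ⟨θ, hθ, hθ1, hθU⟩ := theta hne
  have hcomp : IsCompact N := (isCompact_sphere (0:E) 1).of_isClosed_subset hNc hNs
  have hc := h.cpos
  have hc1 := h.cle
  set ω := θ/16 with hω
  have hω0 : 0 < ω := by positivity
  obtain ⟨Λ2, ts2, hΛ2, hts2, hvis2⟩ := min_visit hNc hNs hmin (half_pos hω0)
  have hΛ20 : 0 < Λ2 := by linarith
  set τ' := ω / Λ2 with hτ'
  have hτ'0 : 0 < τ' := by positivity
  have hτ'ω : τ' ≤ ω := div_le_self hω0.le hΛ2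
  set ρ := c * τ' / 8 with hρ
  have hρ0 : 0 < ρ := by positivity
  have hρτ : ρ ≤ τ' := by
    have := mul_le_mul_of_nonneg_right hc1 hτ'0.le
    rw [hρ]; linarith
  obtain ⟨t, htN, htf, htc⟩ := hcomp.finite_cover_balls hρ0
  set B := htf.toFinset with hB
  have hBN : ∀ β ∈ B, β ∈ N := fun β hβ => htN (by simpa [hB] using hβ)
  have hnet : ∀ q ∈ N, ∃ β ∈ B, ‖q - β‖ ≤ ρ := by
    intro q hq
    obtain ⟨β, hβ, hqβ⟩ : ∃ p ∈ t, q ∈ Metric.ball p ρ := by simpa using htc hq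
    refine ⟨β, by simpa [hB] using hβ, ?_⟩
    rw [← dist_eq_norm]; exact (Metric.mem_ball.1 hqβ).le
  have hBne : B.Nonempty := by
    obtain ⟨q, hq⟩ := hne
    obtain ⟨β, hβ, -⟩ := hnet q hq
    exact ⟨β, hβ⟩
  have hcard : (0:ℝ) < B.card := by exact_mod_cast hBne.card_pos
  set K := 16/θ + 24 * B.card / (c * τ') with hK
  have hK0 : 0 < K := by positivity
  have hK1 : 16 ≤ θ * K := by
    rw [hK, mul_add, mul_div_cancel₀ _ hθ.ne']
    have : 0 ≤ θ * (24 * B.card / (c * τ')) := by positivity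
    linarith
  have hK2 : 24 * B.card ≤ c * τ' * K := by
    rw [hK, mul_add, mul_div_cancel₀ _ (mul_pos hc hτ'0).ne']
    have : 0 ≤ c * τ' * (16/θ) := by positivity
    linarith
  set τ := min (θ/16) (min (c * τ' / (16 * B.card)) (1/K)) with hτ
  have hτ0 : 0 < τ := by positivity
  have hτ1 : τ ≤ θ/16 := min_le_left _ _
  have hτ3 : B.card * τ ≤ c * τ' / 16 := by
    have : τ ≤ c * τ' / (16 * B.card) := (min_le_right _ _).trans (min_le_left _ _)
    rw [le_div_iff₀ (by positivity)] at this
    linarith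
  have hτK : τ * K ≤ 1 := by
    have : τ ≤ 1/K := (min_le_right _ _).trans (min_le_right _ _)
    rwa [le_div_iff₀ (by positivity)] at this
  obtain ⟨Λ, ts, hΛ, hts, hvis⟩ := min_visit hNc hNs hmin (half_pos hτ0)
  have hΛ0 : 0 < Λ := by linarith
  obtain ⟨g, hg⟩ : ∃ g, g = c / (4*Λ) := ⟨_, rfl⟩
  have hg0 : 0 < g := by rw [hg]; positivity
  obtain ⟨P, hP, hpack⟩ := packing (E := E) (ε := g/(8*K)) (by positivity)
  have hP0 : (0:ℝ) < P := by exact_mod_cast hP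
  obtain ⟨C, hC⟩ : ∃ C, C = 8 * P / g := ⟨_, rfl⟩
  have hC0 : 0 < C := by rw [hC]; positivity
  obtain ⟨c'', hc''⟩ : ∃ c'', c'' = c * τ' / 4 := ⟨_, rfl⟩
  have hc''0 : 0 < c'' := by rw [hc'']; positivity
  obtain ⟨A, hA⟩ : ∃ A, A = 4 * C / c'' := ⟨_, rfl⟩
  have hA0 : 0 < A := by rw [hA]; positivity
  obtain ⟨B0, hB0⟩ : ∃ B0, B0 = 2 * C * K + 6 * B.card * A := ⟨_, rfl⟩
  have hB00 : 0 < B0 := by rw [hB0]; positivity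
  obtain ⟨hh, hhh⟩ : ∃ hh, hh = 4 * K * Λ + 1/τ' + 1 := ⟨_, rfl⟩
  have hhpos : 0 < hh := by rw [hhh]; positivity
  obtain ⟨E0, hE0⟩ : ∃ E0, E0 = C * hh + Λ := ⟨_, rfl⟩
  have hE00 : 0 < E0 := by rw [hE0]; positivity
  obtain ⟨Lb, hLb⟩ : ∃ Lb, Lb = A * (B.card * hh) + 4 * B0 * Λ + E0 + 1 + Λ := ⟨_, rfl⟩
  have hLb0 : 0 < Lb := by rw [hLb]; positivity
  have hpos0 : ∀ᶠ t in nhdsWithin (0:ℝ) (Set.Ioi 0), 0 < t := by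
    filter_upwards [self_mem_nhdsWithin] with t ht using ht
  obtain ⟨t1, ht10, q1, q2, q3, q4, q5, q6, q7, q8, q9, q10⟩ :=
    (hpos0.and
    ((ev_small hts2 1).and ((ev_small hts 1).and ((ev_small (half_pos hω0) 1).and
    ((ev_small (half_pos hτ0) 1).and ((ev_small (half_pos hg0) 1).and
    ((ev_small (by positivity : 0 < g/(4*K)) (8*P/g)).and ((ev_small hω0 C).and
    ((ev_small (by positivity : 0 < c * τ' / 8) ((B.card + 1) * C)).and
    ((ev_small one_pos (C * K)).and (ev_small hω0 (Lb+1)))))))))))).exists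
  rw [mul_one] at q1 q2 q3 q4 q5
  obtain ⟨a0, b1, D, hD1, hlen1, hnear1⟩ := hNE Lb t1 ht10
  have hDp := hD1.pos
  have hex : ∃ b, Lb * D ≤ lam x b - lam x a0 := ⟨b1, hlen1⟩
  obtain ⟨b0, hb0, hb0min⟩ : ∃ b0, Lb * D ≤ lam x b0 - lam x a0 ∧
      ∀ b < b0, ¬ Lb * D ≤ lam x b - lam x a0 :=
    ⟨Nat.find hex, Nat.find_spec hex, fun b hb => Nat.find_min hex hb⟩
  have hb01 : b0 ≤ b1 := by
    by_contra hcon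
    exact hb0min b1 (not_le.1 hcon) hlen1
  have hab : a0 < b0 := by
    by_contra hcon
    have := lam_mono x (not_lt.1 hcon)
    have := mul_pos hLb0 hDp
    linarith
  have hD : CurveSys x n a0 b0 D := hD1.mono le_rfl hb01 le_rfl
  have hnear : NearW n N a0 b0 t1 := fun i h1 h2 => hnear1 i h1 (by omega)
  have hL2 : lam x b0 - lam x a0 ≤ (Lb+1) * D := by
    obtain ⟨k, hk⟩ := Nat.exists_eq_add_of_lt hab
    have h1 := hb0min (a0+k) (by omega)
    have h2 := hD.step (a0+k) (by omega) (by omega)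
    rw [hk, lam_succ]
    push Not at h1
    linarith
  have hp : ∀ i, ∃ p, a0 ≤ i → i < b0 → p ∈ N ∧ ‖n i - p‖ ≤ t1 := by
    intro i
    by_cases hi : a0 ≤ i ∧ i < b0
    · obtain ⟨p, h1, h2⟩ := hnear i hi.1 hi.2
      exact ⟨p, fun _ _ => ⟨h1, h2⟩⟩
    · exact ⟨0, fun h1 h2 => absurd ⟨h1, h2⟩ hi⟩
  choose p hp using hp
  set U := Submodule.span ℝ N with hU
  have w : Win x n p (U.starProjection : E →ₗ[ℝ] E) N a0 b0 t1 := by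
    refine ⟨fun t h1 h2 => (hp t h1 h2).1, fun t h1 h2 => (hp t h1 h2).2,
      fun q hq => mem_sphere_zero_iff_norm.1 (hNs hq), ?_, ?_, ht10.le⟩
    · intro v
      have h1 := U.starProjection.le_opNorm v
      have h2 := mul_le_mul_of_nonneg_right (Submodule.starProjection_norm_le U) (norm_nonneg v)
      simp only [ContinuousLinearMap.coe_coe]
      linarith
    · intro q hq v
      have h1 := Submodule.inner_starProjection_left_eq_right U q v
      rw [Submodule.starProjection_eq_self_iff.2 (Submodule.subset_span hq)] at h1
      exact h1
  have hminprop : ∀ Λ τ ts : ℝ, t1 ≤ τ/2 → t1 ≤ ts →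
      (∀ a b D, CurveSys x n a b D → Λ * D ≤ lam x b - lam x a →
      NearW n N a b ts → ∀ q ∈ N, ∃ i, a ≤ i ∧ i < b ∧ ‖n i - q‖ ≤ τ/2) →
      MinProp x n p N a0 b0 Λ τ := by
    intro Λ τ ts k1 k2 hv a b D' ha hb hC' hl q hq
    obtain ⟨i, h1, h2, h3⟩ := hv a b D' hC' hl (fun i h1 h2 => by
      obtain ⟨r, hr, hr2⟩ := hnear i (by omega) (by omega)
      exact ⟨r, hr, hr2.trans k2⟩) q hq
    refine ⟨i, h1, h2, ?_⟩
    have h4 := (hp i (by omega) (by omega)).2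
    have : p i - q = (n i - q) - (n i - p i) := by abel
    rw [this]
    linarith [norm_sub_le (n i - q) (n i - p i)]
  refine window_contra w h (hminprop Λ τ ts q4 q2 hvis) (hminprop Λ2 ω ts2 q3 q1 hvis2) hBN hBne hnet hθ
    ?_ hτ0.le hτ1 hτ'0 hτ'ω le_rfl hω0 (by linarith) le_rfl hρ0.le (hρτ.trans hτ'ω) hτ'ω ?_ hK1 hK0
    le_rfl hK2 hτ3 hτK hΛ hg hP hpack hC hc'' ?_ hA hB0 ?_ ?_ ?_ hE0 ?_ ?_ q5 q6 q7 ?_ q9 q10 hD hab.le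
    hb0 hL2
  · intro v
    exact hθU _ (Submodule.starProjection_apply_mem U v)
  · rw [hτ', mul_div_cancel₀ _ hΛ20.ne']
  · rw [hc'']; linarith
  · rw [hhh]
    have : 0 < 1/τ' := by positivity
    linarith
  · rw [hhh, add_mul, add_mul, one_div, inv_mul_cancel₀ hτ'0.ne']
    have : 0 ≤ 4 * K * Λ * τ' := by positivity
    linarith
  · rw [hhh]
    have : 0 < 1/τ' := by positivity
    have : 0 < 4 * K * Λ := by positivity
    linarith
  · rw [hLb]; linarith
  · rw [hLb]
    have : 0 < A * (B.card * hh) := by positivity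
    have : 0 < 4 * B0 * Λ := by positivity
    linarith
  · linarith

end DB

namespace DB
set_option linter.unusedSectionVars false
set_option linter.unusedVariables false
variable {E : Type*} [NormedAddCommGroup E] [InnerProductSpace ℝ E]

lemma rate_lemma (a r : ℕ → ℝ) (c0 : ℝ) (hc0 : 0 < c0) (ha : ∀ t, 0 < a t) (hr : ∀ t, 0 ≤ r t)
    (hrt : Tendsto r atTop (nhds 0))
    (hrec : ∀ t, c0 * a t ^ 2 ≤ r t ^ 2 * (a t - a (t+1))) :
    Tendsto (fun t : ℕ => (t:ℝ) * a t) atTop (nhds 0) := by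
  rw [Metric.tendsto_atTop]
  intro η hη
  set κ := η * c0 / 4 with hκ
  have hκ0 : 0 < κ := by positivity
  have h2 : Tendsto (fun t => r t ^ 2) atTop (nhds 0) := by simpa using hrt.pow 2
  obtain ⟨T, hT⟩ := eventually_atTop.1 (h2.eventually (gt_mem_nhds hκ0))
  have key : ∀ k : ℕ, (k:ℝ) * (c0 / κ) ≤ 1 / a (T + k) := by
    intro k
    induction k with
    | zero => simp; exact (ha T).le
    | succ k ih =>
      have p1 := ha (T+k)
      have p2 := ha (T+k+1)
      have e1 := hrec (T+k)
      have e2 := hT (T+k) (by omega)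
      have p3 : 0 < a (T+k) - a (T+k+1) := by
        by_contra hcon
        push Not at hcon
        have : r (T+k)^2 * (a (T+k) - a (T+k+1)) ≤ 0 :=
          mul_nonpos_of_nonneg_of_nonpos (sq_nonneg _) hcon
        have : 0 < c0 * a (T+k)^2 := by positivity
        linarith
      have e3 : c0 * a (T+k)^2 ≤ κ * (a (T+k) - a (T+k+1)) :=
        e1.trans (mul_le_mul_of_nonneg_right e2.le p3.le)
      have e4 : c0 / κ ≤ 1 / a (T+k+1) - 1 / a (T+k) := by
        rw [div_sub_div _ _ p2.ne' p1.ne', div_le_div_iff₀ hκ0 (by positivity)]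
        have : c0 * (a (T+k+1) * a (T+k)) ≤ c0 * a (T+k)^2 := by
          apply mul_le_mul_of_nonneg_left _ hc0.le; nlinarith
        linarith
      push_cast
      rw [← add_assoc]
      linarith
  refine ⟨2*T+1, fun t ht => ?_⟩
  obtain ⟨k, rfl⟩ := Nat.exists_eq_add_of_le (by omega : T ≤ t)
  have hk := key k
  have p1 := ha (T+k)
  rw [Real.dist_eq, sub_zero, abs_of_nonneg (by positivity)]
  rw [le_div_iff₀ p1] at hk
  have h4 : c0 / κ = 4 / η := by rw [hκ]; field_simp
  rw [h4] at hk
  have hTk : ((T + k : ℕ):ℝ) ≤ 2 * k := by exact_mod_cast (by omega : T + k ≤ 2 * k)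
  have h5 : (k:ℝ) * a (T+k) ≤ η/4 := by
    have : (k:ℝ) * (4/η) * a (T+k) = (k * a (T+k)) / (η/4) := by field_simp
    rw [this, div_le_one (by positivity)] at hk
    exact hk
  have := mul_le_mul_of_nonneg_right hTk p1.le
  linarith

theorem descent_main [FiniteDimensional ℝ E] (f : E → ℝ) (G : E → E) (hfc : Continuous f)
    (cv : ∀ x y, f x + ⟪G x, y - x⟫ ≤ f y) (x : ℕ → E) {c0 α b : ℝ} (hc0 : 0 < c0) (hα : 0 < α)
    (hdesc : ∀ t, f (x (t+1)) ≤ f (x t) - c0 * ‖G (x t)‖^2)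
    (hlo : ∀ t, α * ‖G (x t)‖ ≤ ‖x (t+1) - x t‖) (hup : ∀ t, ‖x (t+1) - x t‖ ≤ b * ‖G (x t)‖)
    (hb : 0 < b)
    (Nstar : Set E) (hNstar : Nstar = {y | ∀ z, f y ≤ f z}) (hNne : Nstar.Nonempty)
    (fstar : ℝ) (hfstar : ∀ y ∈ Nstar, f y = fstar)
    (Dbar : ℝ) (hDbar : ∀ t, Metric.infDist (x t) Nstar ≤ Dbar) :
    Tendsto (fun t : ℕ => (t : ℝ) * (f (x t) - fstar)) atTop (nhds 0) := by
  have hmem : ∀ y, y ∈ Nstar ↔ ∀ z, f y ≤ f z := fun y => by rw [hNstar]; rfl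
  have hfle : ∀ z, fstar ≤ f z := fun z => by
    obtain ⟨y, hy⟩ := hNne
    rw [← hfstar y hy]; exact (hmem y).1 hy z
  have hanti : Antitone fun t => f (x t) := antitone_nat_of_succ_le fun t => by
    have := hdesc t
    have : 0 ≤ c0 * ‖G (x t)‖^2 := by positivity
    linarith
  by_cases hz : ∃ t, f (x t) = fstar
  · obtain ⟨t0, ht0⟩ := hz
    refine Tendsto.congr' ?_ tendsto_const_nhds
    filter_upwards [eventually_ge_atTop t0] with t ht
    have h1 : f (x t) ≤ f (x t0) := hanti ht
    have : f (x t) = fstar := le_antisymm (by linarith) (hfle _)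
    simp [this]
  push Not at hz
  have hapos : ∀ t, 0 < f (x t) - fstar := fun t => by
    have := lt_of_le_of_ne (hfle (x t)) (hz t).symm
    linarith
  have hGpos : ∀ t, 0 < ‖G (x t)‖ := by
    intro t
    rw [norm_pos_iff]
    intro h0
    obtain ⟨y, hy⟩ := hNne
    have := cv (x t) y
    rw [h0, inner_zero_left, hfstar y hy] at this
    linarith [hapos t]
  have hpt : ∀ t, ∃ q ∈ Nstar, ‖x t - q‖ ≤ Dbar + 1 := by
    intro t
    obtain ⟨q, hq, hd⟩ := (Metric.infDist_lt_iff hNne).1 (lt_of_le_of_lt (hDbar t) (lt_add_one Dbar))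
    exact ⟨q, hq, by rw [← dist_eq_norm]; exact hd.le⟩
  have hDb : 0 ≤ Dbar + 1 := by
    obtain ⟨q, -, hq⟩ := hpt 0
    exact (norm_nonneg _).trans hq
  have hgap : ∀ t, ∀ q ∈ Nstar, f (x t) - fstar ≤ ‖G (x t)‖ * ‖x t - q‖ := by
    intro t q hq
    have h1 := cv (x t) q
    have h2 := real_inner_le_norm (G (x t)) (x t - q)
    rw [← neg_sub (x t) q, inner_neg_right, hfstar q hq] at h1
    linarith
  have hcl : ∀ t, c0 * ‖G (x t)‖^2 ≤ (f (x t) - fstar) - (f (x (t+1)) - fstar) := fun t => by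
    linarith [hdesc t]
  have hGb : ∀ t, ‖G (x t)‖ ≤ (f (x 0) - fstar) / c0 + 1 := by
    intro t
    have h1 := hcl t
    have h2 : f (x t) ≤ f (x 0) := hanti (Nat.zero_le t)
    have h3 : ‖G (x t)‖^2 ≤ (f (x 0) - fstar)/c0 := by
      rw [le_div_iff₀ hc0]; linarith [hapos (t+1)]
    nlinarith [sq_nonneg (‖G (x t)‖ - 1)]
  set n : ℕ → E := fun t => ‖G (x t)‖⁻¹ • G (x t) with hn
  have hninner : ∀ t v, ⟪n t, v⟫ = ⟪G (x t), v⟫ / ‖G (x t)‖ := by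
    intro t v
    simp only [hn, real_inner_smul_left]; rw [div_eq_inv_mul]
  set c := min 1 (c0 / b) with hc
  have hbase : Base x n c := by
    refine ⟨lt_min one_pos (by positivity), min_le_left _ _, fun i => ?_, fun i => ?_, ?_⟩
    · simp only [hn, norm_smul, norm_inv, norm_norm]
      exact inv_mul_cancel₀ (hGpos i).ne'
    · exact lt_of_lt_of_le (mul_pos hα (hGpos i)) (hlo i)
    · intro i j hij
      rw [hninner, div_le_iff₀ (hGpos i)]
      have h1 := cv (x i) (x j)
      have h2 : f (x j) ≤ f (x (i+1)) := hanti hij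
      have h3 := hdesc i
      have h4 : c * dl x i ≤ c0 * ‖G (x i)‖ := by
        have e1 : c * dl x i ≤ (c0 / b) * (b * ‖G (x i)‖) :=
          mul_le_mul (min_le_right _ _) (hup i) (norm_nonneg _) (by positivity)
        have e2 : (c0 / b) * (b * ‖G (x i)‖) = c0 * ‖G (x i)‖ := by field_simp
        linarith
      have h5 := mul_le_mul_of_nonneg_right h4 (hGpos i).le
      nlinarith
  set M := (f (x 0) - fstar) / c0 + 1 with hM
  have hMpos : 0 < M := by have := hapos 0; positivity
  obtain ⟨C, hC⟩ := curve_finite (D0 := b * M + (Dbar + 1)) hbase (fun k => by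
    refine ⟨by positivity, ?_, ?_⟩
    · intro i _ _
      have := (hup i).trans (mul_le_mul_of_nonneg_left (hGb i) hb.le)
      change ‖x (i+1) - x i‖ ≤ _
      linarith
    · intro i j _ hji _
      obtain ⟨q, hq, hqd⟩ := hpt j
      have h1 := cv (x i) q
      rw [hfstar q hq] at h1
      have h2 : ⟪G (x i), q - x i⟫ ≤ 0 := by linarith [hapos i]
      have h3 := real_inner_le_norm (G (x i)) (x j - q)
      have h4 : x j - x i = (x j - q) + (q - x i) := by abel
      rw [hninner, div_le_iff₀ (hGpos i), h4, inner_add_right]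
      have h5 := mul_le_mul_of_nonneg_left hqd (hGpos i).le
      have h6 : 0 ≤ b * M * ‖G (x i)‖ := by positivity
      nlinarith)
  have hsum : Summable fun i => dist (x i) (x (i+1)) := by
    refine summable_of_sum_range_le (c := C) (fun i => dist_nonneg) (fun k => ?_)
    have : ∀ i, dist (x i) (x (i+1)) = dl x i := fun i => by rw [dist_comm, dist_eq_norm]; rfl
    simp only [this]
    exact hC k
  obtain ⟨xi, hxi⟩ := cauchySeq_tendsto_of_complete (cauchySeq_of_summable_dist hsum)
  have hG2 : Summable fun i => ‖G (x i)‖^2 := by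
    refine summable_of_sum_range_le (c := (f (x 0) - fstar)/c0) (fun i => by positivity) (fun k => ?_)
    rw [le_div_iff₀ hc0, mul_comm, Finset.mul_sum]
    have h1 := Finset.sum_le_sum fun i (hi : i ∈ Finset.range k) => hcl i
    rw [Finset.sum_range_sub'] at h1
    linarith [hapos k]
  have hG0 : Tendsto (fun i => ‖G (x i)‖) atTop (nhds 0) := by
    have := hG2.tendsto_atTop_zero.sqrt
    simpa [Real.sqrt_sq (norm_nonneg _)] using this
  have hgap0 : Tendsto (fun t => f (x t)) atTop (nhds fstar) := by
    refine tendsto_of_tendsto_of_tendsto_of_le_of_le tendsto_const_nhds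
      (h := fun t => fstar + ‖G (x t)‖ * (Dbar + 1)) ?_ (fun t => hfle _) (fun t => ?_)
    · simpa using (hG0.mul_const (Dbar+1)).const_add fstar
    · obtain ⟨q, hq, hqd⟩ := hpt t
      have h1 := hgap t q hq
      have h2 := mul_le_mul_of_nonneg_left hqd (hGpos t).le
      simp only
      linarith
  have hfxi : f xi = fstar := tendsto_nhds_unique ((hfc.tendsto xi).comp hxi) hgap0
  have hxiN : xi ∈ Nstar := (hmem xi).2 fun z => by rw [hfxi]; exact hfle z
  refine rate_lemma (fun t => f (x t) - fstar) (fun t => ‖x t - xi‖) c0 hc0 hapos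
    (fun t => norm_nonneg _) ?_ ?_
  · rw [← tendsto_iff_norm_sub_tendsto_zero]; exact hxi
  · intro t
    have h1 := hgap t xi hxiN
    have h2 : (f (x t) - fstar)^2 ≤ (‖G (x t)‖ * ‖x t - xi‖)^2 :=
      pow_le_pow_left₀ (hapos t).le h1 2
    have h3 := mul_le_mul_of_nonneg_left (hcl t) (sq_nonneg ‖x t - xi‖)
    have h4 := mul_le_mul_of_nonneg_left h2 hc0.le
    rw [mul_pow] at h4
    linarith

end DB

namespace DB
set_option linter.unusedSectionVars false
set_option linter.unusedVariables false

lemma taylor_real (φ ψ χ : ℝ → ℝ) (M : ℝ) (h1 : ∀ s, HasDerivAt φ (ψ s) s)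
    (h2 : ∀ s, HasDerivAt ψ (χ s) s) (h3 : ∀ s, 0 ≤ χ s) (h4 : ∀ s, χ s ≤ M) :
    φ 0 + ψ 0 ≤ φ 1 ∧ φ 1 ≤ φ 0 + ψ 0 + M/2 := by
  have m1 : Monotone ψ := monotone_of_deriv_nonneg (fun s => (h2 s).differentiableAt)
    (fun s => by rw [(h2 s).deriv]; exact h3 s)
  have d2 : ∀ s, HasDerivAt (fun s => M * s - ψ s) (M - χ s) s := fun s => by
    have := ((hasDerivAt_id s).const_mul M).sub (h2 s)
    rw [mul_one] at this
    exact this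
  have m2 : Monotone (fun s => M * s - ψ s) :=
    monotone_of_deriv_nonneg (fun s => (d2 s).differentiableAt)
    (fun s => by rw [(d2 s).deriv]; linarith [h4 s])
  have d3 : ∀ s, HasDerivAt (fun s => φ s - s * ψ 0) (ψ s - ψ 0) s := fun s => by
    have := (h1 s).sub ((hasDerivAt_id s).mul_const (ψ 0))
    rw [one_mul] at this
    exact this
  have d4 : ∀ s, HasDerivAt (fun s => s * ψ 0 + M/2 * s^2 - φ s) (ψ 0 + M * s - ψ s) s := fun s => by
    have := (((hasDerivAt_id s).mul_const (ψ 0)).add ((hasDerivAt_pow 2 s).const_mul (M/2))).sub (h1 s)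
    have e : ψ 0 + M * s - ψ s = 1 * ψ 0 + M / 2 * ((2:ℕ) * s ^ (2 - 1)) - ψ s := by
      norm_num; ring
    rw [e]
    exact this
  have m3 : MonotoneOn (fun s => φ s - s * ψ 0) (Set.Icc 0 1) :=
    monotoneOn_of_deriv_nonneg (convex_Icc 0 1) (fun s _ => (d3 s).continuousAt.continuousWithinAt)
      (fun s _ => (d3 s).differentiableAt.differentiableWithinAt) (fun s hs => by
        rw [interior_Icc] at hs
        rw [(d3 s).deriv]; linarith [m1 hs.1.le])
  have m4 : MonotoneOn (fun s => s * ψ 0 + M/2 * s^2 - φ s) (Set.Icc 0 1) :=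
    monotoneOn_of_deriv_nonneg (convex_Icc 0 1) (fun s _ => (d4 s).continuousAt.continuousWithinAt)
      (fun s _ => (d4 s).differentiableAt.differentiableWithinAt) (fun s hs => by
        rw [interior_Icc] at hs
        rw [(d4 s).deriv]
        have := m2 hs.1.le
        simp at this
        linarith)
  have a1 := m3 (by simp) (by simp) (zero_le_one : (0:ℝ) ≤ 1)
  have a2 := m4 (by simp) (by simp) (zero_le_one : (0:ℝ) ≤ 1)
  simp at a1 a2
  constructor <;> linarith

lemma taylor_E {E : Type*} [NormedAddCommGroup E] [InnerProductSpace ℝ E] [CompleteSpace E]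
    (f : E → ℝ) (L : ℝ) (hf : ContDiff ℝ 2 f)
    (hHess : ∀ x v : E, 0 ≤ ⟪(fderiv ℝ (gradient f) x) v, v⟫ ∧
        ⟪(fderiv ℝ (gradient f) x) v, v⟫ ≤ L * ‖v‖ ^ 2) (x v : E) :
    f x + ⟪gradient f x, v⟫ ≤ f (x + v) ∧
      f (x + v) ≤ f x + ⟪gradient f x, v⟫ + L * ‖v‖^2 / 2 := by
  have hd : Differentiable ℝ f := hf.differentiable (by norm_num)
  have hg : Differentiable ℝ (gradient f) := by
    have h1 : Differentiable ℝ (fderiv ℝ f) :=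
      (hf.fderiv_right (m := 1) (by norm_num)).differentiable (by norm_num)
    exact (InnerProductSpace.toDual ℝ E).symm.toContinuousLinearEquiv.differentiable.comp h1
  have hl : ∀ s : ℝ, HasDerivAt (fun s : ℝ => x + s • v) v s := fun s => by
    simpa using ((hasDerivAt_id s).smul_const v).const_add x
  have := taylor_real (fun s => f (x + s • v)) (fun s => ⟪gradient f (x + s • v), v⟫)
    (fun s => ⟪(fderiv ℝ (gradient f) (x + s • v)) v, v⟫) (L * ‖v‖^2)
    (fun s => by
      have h1 := (hd (x + s • v)).hasGradientAt.hasFDerivAt.comp_hasDerivAt s (hl s)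
      rw [InnerProductSpace.toDual_apply_apply] at h1
      exact h1)
    (fun s => by
      have h1 := (hg (x + s • v)).hasFDerivAt.comp_hasDerivAt s (hl s)
      have h2 := h1.inner ℝ (hasDerivAt_const s v)
      simpa using h2)
    (fun s => (hHess _ v).1) (fun s => (hHess _ v).2)
  simpa using this

lemma mat_facts {d : ℕ} (A : Matrix (Fin d) (Fin d) ℝ) {Γ Δ : ℝ} (hΓ : 0 < Γ) (hΓΔ : Γ ≤ Δ)
    (hs : A.IsSymm) (hlo : (A - Γ • 1).PosSemidef)
    (hup : (Δ • (1 : Matrix (Fin d) (Fin d) ℝ) - A).PosSemidef) (g : EuclideanSpace ℝ (Fin d)) :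
    Γ * ‖g‖^2 ≤ ⟪g, Matrix.toEuclideanLin A g⟫ ∧ ‖Matrix.toEuclideanLin A g‖ ≤ Δ * ‖g‖ := by
  set T := Matrix.toEuclideanLin A with hT
  have hin : ∀ u v : EuclideanSpace ℝ (Fin d), ⟪u, T v⟫ = dotProduct u.ofLp (A.mulVec v.ofLp) := by
    intro u v
    rw [hT, EuclideanSpace.inner_eq_star_dotProduct]
    simp [Matrix.toLpLin_apply, dotProduct_comm]
  have hnn : ∀ u : EuclideanSpace ℝ (Fin d), ‖u‖^2 = dotProduct u.ofLp u.ofLp := by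
    intro u
    rw [← real_inner_self_eq_norm_sq, EuclideanSpace.inner_eq_star_dotProduct]
    simp
  have l1 : ∀ u, Γ * ‖u‖^2 ≤ ⟪u, T u⟫ := by
    intro u
    have := hlo.dotProduct_mulVec_nonneg u.ofLp
    rw [hin, hnn]
    simp [Matrix.sub_mulVec, Matrix.smul_mulVec, dotProduct_sub, dotProduct_smul] at this
    linarith
  have l2 : ∀ u, ⟪u, T u⟫ ≤ Δ * ‖u‖^2 := by
    intro u
    have := hup.dotProduct_mulVec_nonneg u.ofLp
    rw [hin, hnn]
    simp [Matrix.sub_mulVec, Matrix.smul_mulVec, dotProduct_sub, dotProduct_smul] at this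
    linarith
  have l3 : ∀ u v, ⟪u, T v⟫ = ⟪T u, v⟫ := by
    intro u v
    rw [real_inner_comm v (T u), hin, hin, Matrix.dotProduct_mulVec, ← Matrix.mulVec_transpose, hs.eq,
      dotProduct_comm]
  refine ⟨l1 g, ?_⟩
  have hΔ : 0 < Δ := hΓ.trans_le hΓΔ
  have e1 := l1 (Δ • g - T g)
  have e2 : 0 ≤ Γ * ‖Δ • g - T g‖^2 := by positivity
  have e3 := l2 (T g)
  have e4 := l2 g
  have e5 : ⟪Δ • g - T g, T (Δ • g - T g)⟫ = Δ^2 * ⟪g, T g⟫ - 2 * Δ * ‖T g‖^2 + ⟪T g, T (T g)⟫ := by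
    rw [map_sub, map_smul, inner_sub_left, inner_sub_right, inner_sub_right, l3 (Δ • g) (T g), map_smul]
    simp only [real_inner_smul_left, real_inner_smul_right, real_inner_self_eq_norm_sq]
    ring
  have e6 : Δ * ‖T g‖^2 ≤ Δ * (Δ * ‖g‖)^2 := by nlinarith [mul_le_mul_of_nonneg_left e4 (sq_nonneg Δ)]
  exact le_of_sq_le_sq (le_of_mul_le_mul_left e6 hΔ) (by positivity)

end DB

/-- Theorem 1 of the paper: sublinear `o(1/t)` convergence of synchronous D-BFGS
(preconditioned gradient descent with symmetric preconditioners whose eigenvalues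
lie in `[Γ, Δ]`) for smooth convex objectives. -/
theorem dbfgs_sync_convex_convergence {d : ℕ}
    (f : EuclideanSpace ℝ (Fin d) → ℝ) (L : ℝ) (hL : 0 < L)
    (hf : ContDiff ℝ 2 f)
    (hHess : ∀ x v : EuclideanSpace ℝ (Fin d),
      0 ≤ ⟪(fderiv ℝ (gradient f) x) v, v⟫ ∧
        ⟪(fderiv ℝ (gradient f) x) v, v⟫ ≤ L * ‖v‖ ^ 2)
    (Nstar : Set (EuclideanSpace ℝ (Fin d)))
    (hNstar : Nstar = {y | ∀ z, f y ≤ f z}) (hNne : Nstar.Nonempty)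
    (fstar : ℝ) (hfstar : ∀ y ∈ Nstar, f y = fstar)
    (Γ Δ : ℝ) (hΓ : 0 < Γ) (hΓΔ : Γ ≤ Δ)
    (ε : ℝ) (hε : 0 < ε) (hεub : ε < 2 * Γ / (L * Δ ^ 2))
    (A : ℕ → Matrix (Fin d) (Fin d) ℝ)
    (hAsymm : ∀ t, (A t).IsSymm)
    (hAlow : ∀ t, (A t - Γ • 1).PosSemidef)
    (hAup : ∀ t, (Δ • (1 : Matrix (Fin d) (Fin d) ℝ) - A t).PosSemidef)
    (x : ℕ → EuclideanSpace ℝ (Fin d))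
    (hx : ∀ t, x (t + 1) = x t - ε • (Matrix.toEuclideanLin (A t)) (gradient f (x t)))
    (Dbar : ℝ) (hDbar : ∀ t, Metric.infDist (x t) Nstar ≤ Dbar) :
    Tendsto (fun t : ℕ => (t : ℝ) * (f (x t) - fstar)) atTop (nhds 0) := by
  have hΔ : 0 < Δ := hΓ.trans_le hΓΔ
  have hT := fun y v => DB.taylor_E f L hf hHess y v
  have hA := fun t g => DB.mat_facts (A t) hΓ hΓΔ (hAsymm t) (hAlow t) (hAup t) g
  rw [lt_div_iff₀ (by positivity)] at hεub
  have hstep : ∀ t, x (t+1) - x t = -(ε • (Matrix.toEuclideanLin (A t)) (gradient f (x t))) := by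
    intro t; rw [hx]; abel
  have hnorm : ∀ t, ‖x (t+1) - x t‖ = ε * ‖(Matrix.toEuclideanLin (A t)) (gradient f (x t))‖ := by
    intro t; rw [hstep, norm_neg, norm_smul, Real.norm_of_nonneg hε.le]
  refine DB.descent_main f (gradient f) hf.continuous ?_ x
    (c0 := ε * Γ - L * ε^2 * Δ^2 / 2) (α := ε * Γ) (b := ε * Δ) ?_ (by positivity) ?_ ?_ ?_
    (by positivity) Nstar hNstar hNne fstar hfstar Dbar hDbar
  · intro y z
    have := (hT y (z - y)).1
    rwa [add_sub_cancel] at this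
  · nlinarith
  · intro t
    have h1 := (hT (x t) (x (t+1) - x t)).2
    obtain ⟨h2, h3⟩ := hA t (gradient f (x t))
    rw [add_sub_cancel, hnorm, hstep, inner_neg_right, real_inner_smul_right] at h1
    have h4 := mul_le_mul_of_nonneg_left h2 hε.le
    have h5 := pow_le_pow_left₀ (norm_nonneg _) h3 2
    have h6 := mul_le_mul_of_nonneg_left h5 (by positivity : 0 ≤ L * ε^2 / 2)
    nlinarith
  · intro t
    obtain ⟨h2, h3⟩ := hA t (gradient f (x t))
    rw [hnorm, mul_assoc]
    apply mul_le_mul_of_nonneg_left _ hε.le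
    have h4 := real_inner_le_norm (gradient f (x t)) ((Matrix.toEuclideanLin (A t)) (gradient f (x t)))
    rcases (norm_nonneg (gradient f (x t))).eq_or_lt with h0 | h0
    · rw [← h0, mul_zero]; positivity
    · apply le_of_mul_le_mul_left _ h0
      nlinarith
  · intro t
    obtain ⟨h2, h3⟩ := hA t (gradient f (x t))
    rw [hnorm, mul_assoc]
    exact mul_le_mul_of_nonneg_left h3 hε.le
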